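/- arXiv:2204.10996 — 10 statements merged into one kernel-verified Lean document; each statement's English description precedes it below -/
import Mathlib

section
/- Let n be even and let N be a 6-net of order n with parallel classes Π_0,…,Π_5, and let R be a relation on N of type (λ_0,…,λ_5). Then for every binary string b = (b_0,…,b_5) ∈ {0,1}^6 with an even number of ones, writing b̄ for the bitwise complement of b, one has 16·(t_b + t_{b̄}) = n^2 + Σ_{0≤i<j≤5} (−1)^{b_i+b_j}·(n−2λ_i)·(n−2λ_j). -/
open scoped Classical

/-- A `k`-net of order `n`: `n ^ 2` points, `k` parallel classes of `n` lines each,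
each line having `n` points, lines within a class pairwise disjoint, and lines from
distinct classes meeting in exactly one point. -/
structure Net (k n : ℕ) where
  classes : Fin k → Finset (Finset (Fin (n ^ 2)))
  card_classes : ∀ i, (classes i).card = n
  card_line : ∀ i, ∀ ℓ ∈ classes i, ℓ.card = n
  disjoint_within : ∀ i, ∀ ℓ₁ ∈ classes i, ∀ ℓ₂ ∈ classes i, ℓ₁ ≠ ℓ₂ → Disjoint ℓ₁ ℓ₂
  one_point : ∀ i j, i ≠ j → ∀ ℓ₁ ∈ classes i, ∀ ℓ₂ ∈ classes j, (ℓ₁ ∩ ℓ₂).card = 1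

namespace Net

variable {k n : ℕ}

/-- The set of all lines of the net. -/
def lineSet (N : Net k n) : Finset (Finset (Fin (n ^ 2))) :=
  Finset.univ.biUnion N.classes

/-- A relation on a net: a set of lines such that every point lies on an even
number of them. -/
def IsRelation (N : Net k n) (R : Finset (Finset (Fin (n ^ 2)))) : Prop :=
  R ⊆ N.lineSet ∧ ∀ p : Fin (n ^ 2), Even (R.filter (fun ℓ => p ∈ ℓ)).card

/-- An odd relation on a net: a set of lines such that every point lies on an odd
number of them. -/
def IsOddRelation (N : Net k n) (R : Finset (Finset (Fin (n ^ 2)))) : Prop :=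
  R ⊆ N.lineSet ∧ ∀ p : Fin (n ^ 2), Odd (R.filter (fun ℓ => p ∈ ℓ)).card

/-- `λ_i`, the number of lines of `R` in the `i`-th parallel class. -/
def relType (N : Net k n) (R : Finset (Finset (Fin (n ^ 2)))) (i : Fin k) : ℕ :=
  (R ∩ N.classes i).card

/-- The weight of a point: the number of lines of `R` through it. -/
def weight (R : Finset (Finset (Fin (n ^ 2)))) (p : Fin (n ^ 2)) : ℕ :=
  (R.filter (fun ℓ => p ∈ ℓ)).card

/-- `p` lies on a line of `R ∩ Π_i`. -/
def OnRel (N : Net k n) (R : Finset (Finset (Fin (n ^ 2)))) (p : Fin (n ^ 2)) (i : Fin k) :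
    Prop :=
  ∃ ℓ ∈ R ∩ N.classes i, p ∈ ℓ

/-- `t_b`: the number of points `p` such that, for every `i`, `p` lies on a line of
`R ∩ Π_i` iff `b i = true`. -/
noncomputable def tcount (N : Net k n) (R : Finset (Finset (Fin (n ^ 2))))
    (b : Fin k → Bool) : ℕ :=
  Nat.card {p : Fin (n ^ 2) // ∀ i, N.OnRel R p i ↔ b i = true}

/-- A relation is trivial if it is a union of parallel classes. -/
def IsTrivial (N : Net k n) (R : Finset (Finset (Fin (n ^ 2)))) : Prop :=
  ∃ s : Finset (Fin k), R = s.biUnion N.classes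

/-- The indicator vector over `𝔽₂` of a line. -/
def lineVec (ℓ : Finset (Fin (n ^ 2))) : Fin (n ^ 2) → ZMod 2 :=
  fun p => if p ∈ ℓ then 1 else 0

/-- `dim N`: the `𝔽₂`-rank of the incidence matrix of the net, i.e. the dimension
of the span of the indicator vectors of its lines. -/
noncomputable def netDim (N : Net k n) : ℕ :=
  Module.finrank (ZMod 2)
    (Submodule.span (ZMod 2) (lineVec '' (N.lineSet : Set (Finset (Fin (n ^ 2))))))

/-- Isomorphism of nets (on the canonical point set): a bijection of points carrying
the lines of one net exactly onto the lines of the other. -/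
def Iso (N₁ N₂ : Net k n) : Prop :=
  ∃ φ : Fin (n ^ 2) ≃ Fin (n ^ 2),
    ∀ ℓ : Finset (Fin (n ^ 2)), ℓ ∈ N₁.lineSet ↔ ℓ.image φ ∈ N₂.lineSet

end Net

namespace Net
variable {k n : ℕ}

/-- incidence count -/
noncomputable def aInd (N : Net k n) (R : Finset (Finset (Fin (n ^ 2)))) (p : Fin (n ^ 2))
    (i : Fin k) : ℤ := ∑ ℓ ∈ R ∩ N.classes i, if p ∈ ℓ then 1 else 0

lemma aInd_eq (N : Net k n) (R : Finset (Finset (Fin (n ^ 2)))) (p : Fin (n ^ 2)) (i : Fin k) :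
    N.aInd R p i = if N.OnRel R p i then 1 else 0 := by
  unfold aInd
  split_ifs with h
  · obtain ⟨m, hm, hp⟩ := h
    rw [Finset.sum_eq_single_of_mem m hm]
    · simp [hp]
    · intro l hl hne
      have := N.disjoint_within i l (Finset.mem_inter.1 hl).2 m (Finset.mem_inter.1 hm).2 hne
      have h2 : p ∉ l := fun h => Finset.disjoint_left.1 this h hp
      simp [h2]
  · apply Finset.sum_eq_zero
    intro l hl
    have h2 : p ∉ l := fun h' => h ⟨l, hl, h'⟩
    simp [h2]

lemma sum_aInd (N : Net k n) (R : Finset (Finset (Fin (n ^ 2)))) (i : Fin k) :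
    ∑ p, N.aInd R p i = N.relType R i * n := by
  unfold aInd relType
  rw [Finset.sum_comm]
  rw [Finset.sum_congr rfl (g := fun _ => (n : ℤ))]
  · simp
  · intro l hl
    have := N.card_line i l (Finset.mem_inter.1 hl).2
    simp [this]

lemma sum_aInd_mul (N : Net k n) (R : Finset (Finset (Fin (n ^ 2)))) (i j : Fin k) (h : i ≠ j) :
    ∑ p, N.aInd R p i * N.aInd R p j = N.relType R i * N.relType R j := by
  unfold aInd relType
  simp_rw [Finset.sum_mul_sum]
  rw [Finset.sum_comm]
  rw [Finset.sum_congr rfl (g := fun _ => ((R ∩ N.classes j).card : ℤ))]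
  · simp
  · intro l hl
    rw [Finset.sum_comm]
    rw [Finset.sum_congr rfl (g := fun _ => (1 : ℤ))]
    · simp
    · intro m hm
      have := N.one_point i j h l (Finset.mem_inter.1 hl).2 m (Finset.mem_inter.1 hm).2
      have h3 : ∀ p, ((if p ∈ l then (1:ℤ) else 0) * if p ∈ m then 1 else 0)
          = if p ∈ l ∩ m then 1 else 0 := by
        intro p
        by_cases h1 : p ∈ l <;> by_cases h2 : p ∈ m <;> simp [h1, h2]
      simp_rw [h3]
      rw [Finset.sum_ite_mem]
      simp [this]

lemma even_aInd (N : Net k n) (hn : Even n) (R : Finset (Finset (Fin (n ^ 2))))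
    (hR : N.IsRelation R) (p : Fin (n ^ 2)) : Even (∑ i, N.aInd R p i) := by
  have hU : R = Finset.univ.biUnion (fun i => R ∩ N.classes i) := by
    rw [← Finset.inter_biUnion]
    exact (Finset.inter_eq_left.2 hR.1).symm
  have hd : Set.PairwiseDisjoint (↑(Finset.univ : Finset (Fin k)))
      (fun i => R ∩ N.classes i) := by
    intro i _ j _ hij
    rw [Function.onFun, Finset.disjoint_left]
    intro l h1 h2
    have h3 := N.one_point i j hij l (Finset.mem_inter.1 h1).2 l (Finset.mem_inter.1 h2).2
    rw [Finset.inter_self, N.card_line i l (Finset.mem_inter.1 h1).2] at h3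
    subst h3
    revert hn; decide
  have h := hR.2 p
  have : ∑ i, N.aInd R p i = ((R.filter (fun l => p ∈ l)).card : ℤ) := by
    unfold aInd
    rw [← Finset.sum_biUnion hd, ← hU]
    simp
  rw [this]
  exact_mod_cast h

lemma tcount_eq (N : Net k n) (R : Finset (Finset (Fin (n ^ 2)))) (b : Fin k → Bool) :
    (N.tcount R b : ℤ) = ∑ p, if (∀ i, N.OnRel R p i ↔ b i = true) then 1 else 0 := by
  unfold tcount
  rw [Nat.card_eq_fintype_card, Fintype.card_subtype]
  simp

end Net

lemma six_aux : ∀ e0 e1 e2 e3 e4 e5 : Bool,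
    (xor e0 (xor e1 (xor e2 (xor e3 (xor e4 e5)))) = false) →
    let f : Bool → ℤ := fun e => if e then -1 else 1
    16 * ((if (e0 || e1 || e2 || e3 || e4 || e5) = false then (1:ℤ) else 0) +
      (if (e0 && e1 && e2 && e3 && e4 && e5) = true then (1:ℤ) else 0)) = 1 +
      (f e0 * f e1 + f e0 * f e2 + f e0 * f e3 + f e0 * f e4 + f e0 * f e5 +
       f e1 * f e2 + f e1 * f e3 + f e1 * f e4 + f e1 * f e5 +
       f e2 * f e3 + f e2 * f e4 + f e2 * f e5 + f e3 * f e4 + f e3 * f e5 + f e4 * f e5) := by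
  decide

lemma xor_aux (c : Fin 6 → Bool) (h : Even (∑ i, if c i = true then (1:ℤ) else 0)) :
    xor (c 0) (xor (c 1) (xor (c 2) (xor (c 3) (xor (c 4) (c 5))))) = false := by
  rw [Fin.sum_univ_six] at h
  generalize c 0 = c0 at *
  generalize c 1 = c1 at *
  generalize c 2 = c2 at *
  generalize c 3 = c3 at *
  generalize c 4 = c4 at *
  generalize c 5 = c5 at *
  revert c0 c1 c2 c3 c4 c5
  decide

lemma point_aux (b c : Fin 6 → Bool)
    (hb : Even (∑ i, if b i = true then (1:ℤ) else 0))
    (hc : Even (∑ i, if c i = true then (1:ℤ) else 0)) :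
    (16 : ℤ) * ((if (∀ i, c i = true ↔ b i = true) then 1 else 0) +
      (if (∀ i, c i = true ↔ (! b i) = true) then 1 else 0)) =
    1 + ∑ i : Fin 6, ∑ j : Fin 6, (if i < j then
            (-1 : ℤ) ^ (((if b i then 1 else 0) + (if b j then 1 else 0) : ℕ)) *
              ((1 - 2 * (if c i = true then 1 else 0)) * (1 - 2 * (if c j = true then 1 else 0)))
          else 0) := by
  have hb' := xor_aux b hb
  have hc' := xor_aux c hc
  have key := six_aux (xor (b 0) (c 0)) (xor (b 1) (c 1)) (xor (b 2) (c 2)) (xor (b 3) (c 3))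
    (xor (b 4) (c 4)) (xor (b 5) (c 5)) (by
      have h := congrArg₂ xor hb' hc'
      rw [Bool.xor_false] at h
      rw [← h]
      simp only [Bool.xor_assoc, Bool.xor_left_comm, Bool.xor_comm])
  have e1 : (∀ i, c i = true ↔ b i = true) ↔ ((xor (b 0) (c 0)) || (xor (b 1) (c 1)) ||
    (xor (b 2) (c 2)) || (xor (b 3) (c 3)) || (xor (b 4) (c 4)) || (xor (b 5) (c 5))) = false := by
    have : ∀ x y : Bool, (x = true ↔ y = true) ↔ (xor y x) = false := by decide
    simp only [this, Bool.or_eq_false_iff]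
    simp [Fin.forall_fin_succ, and_assoc]
  have e2 : (∀ i, c i = true ↔ (! b i) = true) ↔ ((xor (b 0) (c 0)) && (xor (b 1) (c 1)) &&
    (xor (b 2) (c 2)) && (xor (b 3) (c 3)) && (xor (b 4) (c 4)) && (xor (b 5) (c 5))) = true := by
    have : ∀ x y : Bool, (x = true ↔ (!y) = true) ↔ (xor y x) = true := by decide
    simp only [this, Bool.and_eq_true]
    simp [Fin.forall_fin_succ, and_assoc]
  have e3 : ∀ x y z w : Bool, (-1 : ℤ) ^ (((if x then 1 else 0) + (if y then 1 else 0) : ℕ)) *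
      ((1 - 2 * (if z = true then 1 else 0)) * (1 - 2 * (if w = true then 1 else 0)))
      = (if (xor x z) then -1 else 1) * (if (xor y w) then -1 else 1) := by decide
  simp only [e3]
  simp only [e1, e2]
  refine key.trans ?_
  simp only [Fin.sum_univ_six]
  simp [Fin.lt_def]
  ring

/-- For a relation `R` on a `6`-net of even order `n` and any binary
string `b` of length 6 with an even number of ones,
`16 (t_b + t_b̄) = n² + Σ_{i<j} (-1)^{b_i+b_j} (n-2λ_i)(n-2λ_j)`. -/
theorem statement1 (n : ℕ) (hn : Even n) (N : Net 6 n)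
    (R : Finset (Finset (Fin (n ^ 2)))) (hR : N.IsRelation R)
    (b : Fin 6 → Bool)
    (hb : Even (Finset.univ.filter (fun i => b i = true)).card) :
    (16 : ℤ) * ((N.tcount R b : ℤ) + (N.tcount R (fun i => ! b i) : ℤ)) =
      (n : ℤ) ^ 2 +
        ∑ i : Fin 6, ∑ j : Fin 6,
          (if i < j then
            (-1 : ℤ) ^ (((if b i then 1 else 0) + (if b j then 1 else 0) : ℕ)) *
              ((n : ℤ) - 2 * (N.relType R i : ℤ)) * ((n : ℤ) - 2 * (N.relType R j : ℤ))
          else 0) := by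
  have hb' : Even (∑ i, if b i = true then (1:ℤ) else 0) := by
    rw [Finset.sum_boole]; exact_mod_cast hb
  have hp : ∀ p, (16 : ℤ) * ((if (∀ i, N.OnRel R p i ↔ b i = true) then 1 else 0) +
      (if (∀ i, N.OnRel R p i ↔ (! b i) = true) then 1 else 0)) =
    1 + ∑ i : Fin 6, ∑ j : Fin 6, (if i < j then
            (-1 : ℤ) ^ (((if b i then 1 else 0) + (if b j then 1 else 0) : ℕ)) *
              ((1 - 2 * N.aInd R p i) * (1 - 2 * N.aInd R p j))
          else 0) := by
    intro p
    have h1 := N.even_aInd hn R hR p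
    have h2 := point_aux b (fun i => decide (N.OnRel R p i)) hb'
    simp only [decide_eq_true_eq, ← Net.aInd_eq] at h2
    exact h2 h1
  rw [N.tcount_eq, N.tcount_eq, ← Finset.sum_add_distrib, Finset.mul_sum,
    Finset.sum_congr rfl (fun p _ => hp p), Finset.sum_add_distrib]
  congr 1
  · simp
  rw [Finset.sum_comm]
  refine Finset.sum_congr rfl fun i _ => ?_
  rw [Finset.sum_comm]
  refine Finset.sum_congr rfl fun j _ => ?_
  split_ifs with hij
  all_goals try simp only [Finset.sum_const_zero]
  all_goals
    rw [← Finset.mul_sum, mul_assoc]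
    congr 1
    have : ∀ p, (1 - 2 * N.aInd R p i) * (1 - 2 * N.aInd R p j) =
      1 - 2 * N.aInd R p i - 2 * N.aInd R p j + 4 * (N.aInd R p i * N.aInd R p j) := by
      intro p; ring
    simp only [this, Finset.sum_add_distrib, Finset.sum_sub_distrib, ← Finset.mul_sum,
      N.sum_aInd, N.sum_aInd_mul R i j hij.ne]
    simp
    ring
end

section
/- Let n be even and let N be a 5-net of order n with parallel classes Π_0,…,Π_4, and let R be a relation on N of type (λ_0,…,λ_4). Then for every b = (b_0,…,b_4) ∈ {0,1}^5 with an even number of ones, 16·t_b = n^2 + n·Σ_{i=0}^{4}(−1)^{b_i}(n−2λ_i) + Σ_{0≤i<j≤4}(−1)^{b_i+b_j}(n−2λ_i)(n−2λ_j); and t_b = 0 for every b ∈ {0,1}^5 with an odd number of ones. -/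
open scoped Classical

namespace Net

variable {k n : ℕ}

/-- Indicator of being on a relational line of class `i`. -/
noncomputable def xx (N : Net k n) (R : Finset (Finset (Fin (n ^ 2)))) (p : Fin (n ^ 2))
    (i : Fin k) : ℕ := ∑ ℓ ∈ R ∩ N.classes i, if p ∈ ℓ then 1 else 0

lemma xx_eq (N : Net k n) (R : Finset (Finset (Fin (n ^ 2)))) (p : Fin (n ^ 2)) (i : Fin k) :
    N.xx R p i = if N.OnRel R p i then 1 else 0 := by
  unfold xx
  split_ifs with h
  · obtain ⟨ℓ, hℓ, hp⟩ := h
    rw [Finset.sum_eq_single ℓ]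
    · simp [hp]
    · intro m hm hne
      rw [if_neg]
      intro hpm
      have := N.disjoint_within i m (Finset.mem_inter.1 hm).2 ℓ (Finset.mem_inter.1 hℓ).2 hne
      exact Finset.disjoint_left.1 this hpm hp
    · intro h; exact absurd hℓ h
  · apply Finset.sum_eq_zero
    intro ℓ hℓ
    rw [if_neg]
    intro hp
    exact h ⟨ℓ, hℓ, hp⟩

lemma sum_xx (N : Net k n) (R : Finset (Finset (Fin (n ^ 2)))) (i : Fin k) :
    ∑ p, N.xx R p i = n * N.relType R i := by
  unfold xx relType
  rw [Finset.sum_comm, Finset.sum_congr rfl (g := fun _ => n)]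
  · simp [mul_comm]
  · intro ℓ hℓ
    refine Eq.trans ?_ (N.card_line i ℓ (Finset.mem_inter.1 hℓ).2)
    simp

lemma sum_xx_mul (N : Net k n) (R : Finset (Finset (Fin (n ^ 2)))) (i j : Fin k) (hij : i ≠ j) :
    ∑ p, N.xx R p i * N.xx R p j = N.relType R i * N.relType R j := by
  unfold xx relType
  simp_rw [Finset.sum_mul_sum]
  rw [Finset.sum_comm, Finset.sum_congr rfl
    (g := fun _ => (R ∩ N.classes j).card)]
  · simp
  · intro ℓ hℓ
    rw [Finset.sum_comm, Finset.sum_congr rfl (g := fun _ => 1)]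
    · simp
    · intro m hm
      have h := N.one_point i j hij ℓ (Finset.mem_inter.1 hℓ).2 m (Finset.mem_inter.1 hm).2
      refine Eq.trans ?_ h
      have e : ℓ ∩ m = Finset.univ.filter (fun p => p ∈ ℓ ∧ p ∈ m) := by
        ext p
        simp
      rw [e, Finset.card_filter]
      refine Finset.sum_congr rfl fun p _ => ?_
      by_cases h1 : p ∈ ℓ <;> by_cases h2 : p ∈ m <;> simp [h1, h2]

lemma even_sum_xx (hn : Even n) (N : Net k n) (R : Finset (Finset (Fin (n ^ 2))))
    (hR : N.IsRelation R) (p : Fin (n ^ 2)) : Even (∑ i, N.xx R p i) := by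
  have h := hR.2 p
  have e : (R.filter (fun ℓ => p ∈ ℓ)).card = ∑ i, N.xx R p i := by
    have hRU : R = Finset.univ.biUnion (fun i => R ∩ N.classes i) := by
      ext ℓ
      constructor
      · intro hℓ
        have := hR.1 hℓ
        simp only [lineSet, Finset.mem_biUnion, Finset.mem_univ, true_and] at this
        obtain ⟨i, hi⟩ := this
        simp only [Finset.mem_biUnion, Finset.mem_univ, true_and]
        exact ⟨i, Finset.mem_inter.2 ⟨hℓ, hi⟩⟩
      · intro hℓ
        simp only [Finset.mem_biUnion, Finset.mem_univ, true_and] at hℓ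
        obtain ⟨i, hi⟩ := hℓ
        exact (Finset.mem_inter.1 hi).1
    rw [Finset.card_filter]
    conv_lhs => rw [hRU]
    rw [Finset.sum_biUnion]
    · rfl
    · intro i _ j _ hij
      refine Finset.disjoint_left.2 ?_
      intro ℓ hi hj
      have hi := (Finset.mem_inter.1 hi).2
      have h1 := N.one_point i j hij ℓ hi ℓ (Finset.mem_inter.1 hj).2
      have h2 := N.card_line i ℓ hi
      rw [Finset.inter_self] at h1
      have : n = 1 := by omega
      rw [this] at hn
      exact absurd hn (by decide)
  rwa [e] at h

end Net

lemma five_id (u : Fin 5 → ℤ) (hu : ∀ i, u i = 1 ∨ u i = -1) (hp : ∏ i, u i = 1) :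
    16 * (if ∀ i, u i = 1 then (1 : ℤ) else 0) =
      1 + ∑ i, u i + ∑ i : Fin 5, ∑ j : Fin 5, (if i < j then u i * u j else 0) := by
  have h0 := hu 0
  have h1 := hu 1
  have h2 := hu 2
  have h3 := hu 3
  have h4 := hu 4
  simp only [Fin.prod_univ_five, Fin.sum_univ_five, Fin.forall_fin_succ] at *
  simp (decide := true) only [if_true, if_false]
  rcases h0 with h0 | h0 <;> rcases h1 with h1 | h1 <;> rcases h2 with h2 | h2 <;>
    rcases h3 with h3 | h3 <;> rcases h4 with h4 | h4 <;>
    simp [h0, h1, h2, h3, h4] at hp ⊢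

lemma prod_sign (b : Fin 5 → Bool) (h : Even (Finset.univ.filter (fun i => b i = true)).card) :
    ∏ i, (-1 : ℤ) ^ ((if b i then 1 else 0 : ℕ)) = 1 := by
  rw [Finset.prod_pow_eq_pow_sum, ← Finset.card_filter]
  exact h.neg_one_pow

/-- For a relation `R` on a `5`-net of even order `n`: for every binary
string `b` of length 5 with an even number of ones,
`16 t_b = n² + n Σ_i (-1)^{b_i}(n-2λ_i) + Σ_{i<j} (-1)^{b_i+b_j}(n-2λ_i)(n-2λ_j)`,
and `t_b = 0` for every `b` with an odd number of ones. -/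
theorem statement2 (n : ℕ) (hn : Even n) (N : Net 5 n)
    (R : Finset (Finset (Fin (n ^ 2)))) (hR : N.IsRelation R) :
    (∀ b : Fin 5 → Bool, Even (Finset.univ.filter (fun i => b i = true)).card →
      (16 : ℤ) * (N.tcount R b : ℤ) =
        (n : ℤ) ^ 2 +
          (n : ℤ) * ∑ i : Fin 5,
            (-1 : ℤ) ^ ((if b i then 1 else 0 : ℕ)) * ((n : ℤ) - 2 * (N.relType R i : ℤ)) +
          ∑ i : Fin 5, ∑ j : Fin 5,
            (if i < j then
              (-1 : ℤ) ^ (((if b i then 1 else 0) + (if b j then 1 else 0) : ℕ)) *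
                ((n : ℤ) - 2 * (N.relType R i : ℤ)) * ((n : ℤ) - 2 * (N.relType R j : ℤ))
            else 0)) ∧
    (∀ b : Fin 5 → Bool, Odd (Finset.univ.filter (fun i => b i = true)).card →
      N.tcount R b = 0) := by

  constructor
  · intro b hb
    have key : ∀ p, 16 * (if ∀ i, N.OnRel R p i ↔ b i = true then (1 : ℤ) else 0) =
      1 + ∑ i, (-1 : ℤ) ^ ((if b i then 1 else 0 : ℕ)) * (1 - 2 * (N.xx R p i : ℤ)) +
      ∑ i : Fin 5, ∑ j : Fin 5, (if i < j then
        (-1 : ℤ) ^ (((if b i then 1 else 0) + (if b j then 1 else 0) : ℕ)) *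
        (1 - 2 * (N.xx R p i : ℤ) - 2 * (N.xx R p j : ℤ)
          + 4 * ((N.xx R p i * N.xx R p j : ℕ) : ℤ)) else 0) := by
      intro p
      have hs : ∀ i, (1 - 2 * (N.xx R p i : ℤ)) = (-1) ^ (N.xx R p i) := by
        intro i
        rw [N.xx_eq]
        split_ifs <;> norm_num
      have := five_id (fun i => (-1 : ℤ) ^ ((if b i then 1 else 0 : ℕ)) * (1 - 2 * (N.xx R p i : ℤ)))
        (by
          intro i
          simp only [hs, ← pow_add]
          exact neg_one_pow_eq_or _ _)
        (by
          rw [Finset.prod_mul_distrib, prod_sign b hb]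
          simp only [hs]
          rw [Finset.prod_pow_eq_pow_sum, (N.even_sum_xx hn R hR p).neg_one_pow, one_mul])
      convert this using 2
      · have : (∀ i, N.OnRel R p i ↔ b i = true) ↔
          ∀ i, (-1 : ℤ) ^ ((if b i then 1 else 0 : ℕ)) * (1 - 2 * (N.xx R p i : ℤ)) = 1 := by
          refine forall_congr' fun i => ?_
          rw [N.xx_eq]
          by_cases h1 : N.OnRel R p i <;> by_cases h2 : b i = true <;> simp [h1, h2]
        simp only [this]
      · refine Finset.sum_congr rfl fun i _ => Finset.sum_congr rfl fun j _ => ?_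
        split_ifs <;> push_cast <;> ring
    have ht : (N.tcount R b : ℤ) =
        ∑ p, (if ∀ i, N.OnRel R p i ↔ b i = true then (1 : ℤ) else 0) := by
      unfold Net.tcount
      rw [Nat.card_eq_fintype_card, Fintype.card_subtype, Finset.card_filter]
      push_cast
      rfl
    have hS : ∀ i, ∑ p, (N.xx R p i : ℤ) = n * N.relType R i := by
      intro i
      exact_mod_cast N.sum_xx R i
    have hS2 : ∀ i j, i ≠ j → ∑ p, ((N.xx R p i * N.xx R p j : ℕ) : ℤ)
        = N.relType R i * N.relType R j := by
      intro i j hij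
      exact_mod_cast N.sum_xx_mul R i j hij
    rw [ht, Finset.mul_sum, Finset.sum_congr rfl (fun p _ => key p), Finset.sum_add_distrib,
      Finset.sum_add_distrib]
    congr 1
    · congr 1
      · simp
      · rw [Finset.sum_comm, Finset.mul_sum]
        refine Finset.sum_congr rfl fun i _ => ?_
        rw [← Finset.mul_sum, Finset.sum_sub_distrib, ← Finset.mul_sum, hS]
        simp
        ring
    · rw [Finset.sum_comm]
      refine Finset.sum_congr rfl fun i _ => ?_
      rw [Finset.sum_comm]
      refine Finset.sum_congr rfl fun j _ => ?_
      by_cases hij : i < j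
      · simp only [if_pos hij]
        rw [← Finset.mul_sum, Finset.sum_add_distrib, Finset.sum_sub_distrib,
          Finset.sum_sub_distrib, ← Finset.mul_sum, ← Finset.mul_sum, ← Finset.mul_sum,
          hS, hS, hS2 i j hij.ne]
        simp
        ring
      · simp [hij]
  · intro b hb
    unfold Net.tcount
    rw [Nat.card_eq_zero]
    left
    constructor
    rintro ⟨p, hp⟩
    have h := N.even_sum_xx hn R hR p
    rw [Finset.sum_congr rfl (g := fun i => if b i = true then 1 else 0)] at h
    · rw [← Finset.card_filter] at h
      exact (Nat.not_even_iff_odd.2 hb) h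
    · intro i _
      rw [N.xx_eq]
      simp only [hp i]
end

section
/- Let n be even and let N be a 4-net of order n with parallel classes Π_0,…,Π_3, and let R be a relation on N of type (λ_0,…,λ_3). Then for every b = (b_0,…,b_3) ∈ {0,1}^4 with an even number of ones, 16·t_b = 2n^2 + 2n·Σ_{i=0}^{3}(−1)^{b_i}(n−2λ_i) + Σ_{0≤i<j≤3}(−1)^{b_i+b_j}(n−2λ_i)(n−2λ_j); and t_b = 0 for every b ∈ {0,1}^4 with an odd number of ones. -/
open scoped Classical

namespace Net

/-- number of lines of `R` in class `i` through `p`. -/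
noncomputable def acnt {k n : ℕ} (N : Net k n) (R : Finset (Finset (Fin (n ^ 2))))
    (i : Fin k) (p : Fin (n ^ 2)) : ℕ :=
  ((R ∩ N.classes i).filter (fun ℓ => p ∈ ℓ)).card

theorem acnt_le {k n : ℕ} (N : Net k n) (R : Finset (Finset (Fin (n ^ 2))))
    (i : Fin k) (p : Fin (n ^ 2)) : N.acnt R i p ≤ 1 := by
  unfold acnt
  rw [Finset.card_le_one]
  intro a ha b hb
  simp only [Finset.mem_filter, Finset.mem_inter] at ha hb
  by_contra hab
  exact Finset.disjoint_left.mp (N.disjoint_within i a ha.1.2 b hb.1.2 hab) ha.2 hb.2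

theorem onRel_iff {k n : ℕ} (N : Net k n) (R : Finset (Finset (Fin (n ^ 2))))
    (i : Fin k) (p : Fin (n ^ 2)) : N.OnRel R p i ↔ N.acnt R i p = 1 := by
  have h := N.acnt_le R i p
  have h2 : N.OnRel R p i ↔ 0 < N.acnt R i p := by
    unfold acnt OnRel
    rw [Finset.card_pos]
    constructor
    · rintro ⟨l, hl, hp⟩
      exact ⟨l, Finset.mem_filter.mpr ⟨hl, hp⟩⟩
    · rintro ⟨l, hl⟩
      exact ⟨l, (Finset.mem_filter.mp hl).1, (Finset.mem_filter.mp hl).2⟩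
  rw [h2]; omega

theorem acnt_eq {k n : ℕ} (N : Net k n) (R : Finset (Finset (Fin (n ^ 2))))
    (i : Fin k) (p : Fin (n ^ 2)) :
    (N.acnt R i p : ℤ) = ∑ l ∈ R ∩ N.classes i, if p ∈ l then 1 else 0 := by
  unfold acnt
  rw [Finset.card_filter]; push_cast; rfl

theorem sum_acnt {k n : ℕ} (N : Net k n) (R : Finset (Finset (Fin (n ^ 2))))
    (i : Fin k) : ∑ p, (N.acnt R i p : ℤ) = n * N.relType R i := by
  simp_rw [acnt_eq]
  rw [Finset.sum_comm]
  have : ∀ l ∈ R ∩ N.classes i, (∑ p, if p ∈ l then (1:ℤ) else 0) = n := by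
    intro l hl
    have := N.card_line i l (Finset.mem_inter.mp hl).2
    simp [this]
  rw [Finset.sum_congr rfl this]
  simp [relType, mul_comm]

theorem sum_acnt_mul {k n : ℕ} (N : Net k n) (R : Finset (Finset (Fin (n ^ 2))))
    (i j : Fin k) (hij : i ≠ j) :
    ∑ p, (N.acnt R i p : ℤ) * N.acnt R j p = N.relType R i * N.relType R j := by
  simp_rw [acnt_eq, Finset.sum_mul_sum]
  rw [Finset.sum_comm]
  have : ∀ l ∈ R ∩ N.classes i, (∑ p, ∑ m ∈ R ∩ N.classes j,
      (if p ∈ l then (1:ℤ) else 0) * (if p ∈ m then 1 else 0)) = N.relType R j := by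
    intro l hl
    rw [Finset.sum_comm]
    have : ∀ m ∈ R ∩ N.classes j, (∑ p,
      (if p ∈ l then (1:ℤ) else 0) * (if p ∈ m then 1 else 0)) = 1 := by
      intro m hm
      have h := N.one_point i j hij l (Finset.mem_inter.mp hl).2 m (Finset.mem_inter.mp hm).2
      have h2 : ∀ p, (if p ∈ l then (1:ℤ) else 0) * (if p ∈ m then 1 else 0)
          = if p ∈ l ∩ m then 1 else 0 := by
        intro p
        by_cases h1 : p ∈ l <;> by_cases h2 : p ∈ m <;> simp [h1, h2]
      rw [Finset.sum_congr rfl (fun p _ => h2 p), Finset.sum_ite_mem]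
      simp [h]
    rw [Finset.sum_congr rfl this]
    simp [relType]
  rw [Finset.sum_congr rfl this]
  simp [relType]

theorem even_acnt {k n : ℕ} (hn : Even n) (N : Net k n) (R : Finset (Finset (Fin (n ^ 2))))
    (hR : N.IsRelation R) (p : Fin (n ^ 2)) : Even (∑ i, N.acnt R i p) := by
  have h := hR.2 p
  have e : R.filter (fun l => p ∈ l) =
      Finset.univ.biUnion (fun i => (R ∩ N.classes i).filter (fun l => p ∈ l)) := by
    ext l
    simp only [Finset.mem_filter, Finset.mem_biUnion, Finset.mem_univ, true_and,
      Finset.mem_inter]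
    constructor
    · rintro ⟨h1, h2⟩
      have := hR.1 h1
      simp only [lineSet, Finset.mem_biUnion, Finset.mem_univ, true_and] at this
      obtain ⟨i, hi⟩ := this
      exact ⟨i, ⟨h1, hi⟩, h2⟩
    · rintro ⟨i, ⟨h1, hi⟩, h2⟩
      exact ⟨h1, h2⟩
  rw [e, Finset.card_biUnion] at h
  · exact h
  · intro i _ j _ hij
    change Disjoint _ _
    rw [Finset.disjoint_left]
    intro l h1 h2
    simp only [Finset.mem_filter, Finset.mem_inter] at h1 h2
    have a := N.one_point i j hij l h1.1.2 l h2.1.2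
    rw [Finset.inter_self, N.card_line i l h1.1.2] at a
    subst a
    exact absurd hn (by decide)

end Net

theorem sign_id (x y : Fin 4 → ℤ) (hx : ∀ i, x i = 1 ∨ x i = -1) (hy : ∀ i, y i = 1 ∨ y i = -1)
    (hxp : x 0 * x 1 * x 2 * x 3 = 1) (hyp : y 0 * y 1 * y 2 * y 3 = 1) :
    (16 : ℤ) * (if ∀ i, x i = y i then 1 else 0) = 2 + 2 * (y 0 * x 0 + y 1 * x 1 + y 2 * x 2
      + y 3 * x 3) + (y 0 * y 1 * (x 0 * x 1) + y 0 * y 2 * (x 0 * x 2) + y 0 * y 3 * (x 0 * x 3)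
      + y 1 * y 2 * (x 1 * x 2) + y 1 * y 3 * (x 1 * x 3) + y 2 * y 3 * (x 2 * x 3)) := by
  simp only [Fin.forall_fin_succ, Fin.isValue] at hx hy ⊢
  simp only [Fin.isValue, Fin.succ_zero_eq_one, Fin.succ_one_eq_two, IsEmpty.forall_iff, and_true,
    show (Fin.succ (2 : Fin 3)) = (3 : Fin 4) from rfl,
    show (Fin.succ (Fin.succ (1 : Fin 2))) = (3 : Fin 4) from rfl,
    show (Fin.succ (1 : Fin 3)) = (2 : Fin 4) from rfl,
    show (Fin.succ (Fin.succ (0 : Fin 2))) = (2 : Fin 4) from rfl,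
    show (Fin.succ (Fin.succ (Fin.succ (0 : Fin 1)))) = (3 : Fin 4) from rfl] at hx hy ⊢
  generalize x 0 = a at *
  generalize x 1 = b at *
  generalize x 2 = c at *
  generalize x 3 = d at *
  generalize y 0 = a' at *
  generalize y 1 = b' at *
  generalize y 2 = c' at *
  generalize y 3 = d' at *
  obtain ⟨rfl | rfl, rfl | rfl, rfl | rfl, rfl | rfl⟩ := hx <;>
  first
  | (exfalso; revert hxp; norm_num; done)
  | (obtain ⟨rfl | rfl, rfl | rfl, rfl | rfl, rfl | rfl⟩ := hy <;>
      first
      | (exfalso; revert hyp; norm_num; done)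
      | norm_num)

theorem bool_even (b : Fin 4 → Bool) (h : Even (Finset.univ.filter (fun i => b i = true)).card) :
    ((-1 : ℤ) ^ (if b 0 then 1 else 0 : ℕ)) * ((-1 : ℤ) ^ (if b 1 then 1 else 0 : ℕ)) *
    ((-1 : ℤ) ^ (if b 2 then 1 else 0 : ℕ)) * ((-1 : ℤ) ^ (if b 3 then 1 else 0 : ℕ)) = 1 := by
  rw [Finset.card_filter, Fin.sum_univ_four] at h
  rw [← pow_add, ← pow_add, ← pow_add]
  exact h.neg_one_pow

/-- For a relation `R` on a `4`-net of even order `n`: for every binary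
string `b` of length 4 with an even number of ones,
`16 t_b = 2n² + 2n Σ_i (-1)^{b_i}(n-2λ_i) + Σ_{i<j} (-1)^{b_i+b_j}(n-2λ_i)(n-2λ_j)`,
and `t_b = 0` for every `b` with an odd number of ones. -/
theorem statement3 (n : ℕ) (hn : Even n) (N : Net 4 n)
    (R : Finset (Finset (Fin (n ^ 2)))) (hR : N.IsRelation R) :
    (∀ b : Fin 4 → Bool, Even (Finset.univ.filter (fun i => b i = true)).card →
      (16 : ℤ) * (N.tcount R b : ℤ) =
        2 * (n : ℤ) ^ 2 +
          2 * (n : ℤ) * ∑ i : Fin 4,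
            (-1 : ℤ) ^ ((if b i then 1 else 0 : ℕ)) * ((n : ℤ) - 2 * (N.relType R i : ℤ)) +
          ∑ i : Fin 4, ∑ j : Fin 4,
            (if i < j then
              (-1 : ℤ) ^ (((if b i then 1 else 0) + (if b j then 1 else 0) : ℕ)) *
                ((n : ℤ) - 2 * (N.relType R i : ℤ)) * ((n : ℤ) - 2 * (N.relType R j : ℤ))
            else 0)) ∧
    (∀ b : Fin 4 → Bool, Odd (Finset.univ.filter (fun i => b i = true)).card →
      N.tcount R b = 0) := by
  classical
  have ha : ∀ i p, N.acnt R i p = 0 ∨ N.acnt R i p = 1 := fun i p => by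
    have := N.acnt_le R i p
    omega
  refine ⟨?_, ?_⟩
  · intro b hb
    have hy := bool_even b hb
    simp only [pow_add]
    set y : Fin 4 → ℤ := fun i => (-1 : ℤ) ^ (if b i then 1 else 0 : ℕ) with hydef
    have hy1 : ∀ i, y i = 1 ∨ y i = -1 := by
      intro i
      by_cases h : b i <;> simp [hydef, h]
    let x : Fin (n ^ 2) → Fin 4 → ℤ := fun p i => 1 - 2 * (N.acnt R i p : ℤ)
    have hx1 : ∀ p i, x p i = 1 ∨ x p i = -1 := by
      intro p i
      rcases ha i p with h | h <;> simp [x, h]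
    have hxp : ∀ p, x p 0 * x p 1 * x p 2 * x p 3 = 1 := by
      intro p
      have he := N.even_acnt hn R hR p
      rw [Fin.sum_univ_four] at he
      have hs : ∀ i, x p i = (-1) ^ (N.acnt R i p) := by
        intro i
        rcases ha i p with h | h <;> simp [x, h]
      rw [hs, hs, hs, hs, ← pow_add, ← pow_add, ← pow_add]
      exact he.neg_one_pow
    have ht : (N.tcount R b : ℤ) = ∑ p, if ∀ i, x p i = y i then 1 else 0 := by
      unfold Net.tcount
      rw [Nat.card_eq_fintype_card, Fintype.card_subtype, Finset.card_filter]
      push_cast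
      refine Finset.sum_congr rfl fun p _ => ?_
      congr 1
      apply propext
      refine forall_congr' fun i => ?_
      rw [Net.onRel_iff]
      rcases ha i p with h | h <;> by_cases h' : b i <;> simp [x, hydef, h, h']
    have s1 : ∀ i, ∑ p, x p i = n * (n - 2 * N.relType R i) := by
      intro i
      simp only [x, Finset.sum_sub_distrib, ← Finset.mul_sum, Net.sum_acnt]
      simp
      ring
    have s2 : ∀ i j, i ≠ j → ∑ p, x p i * x p j =
        (n - 2 * N.relType R i) * (n - 2 * N.relType R j) := by
      intro i j hij
      have e : ∀ p, x p i * x p j = 1 - 2 * (N.acnt R i p : ℤ) - 2 * (N.acnt R j p : ℤ)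
          + 4 * ((N.acnt R i p : ℤ) * N.acnt R j p) := fun p => by simp only [x]; ring
      simp only [e, Finset.sum_add_distrib, Finset.sum_sub_distrib, ← Finset.mul_sum,
        Net.sum_acnt, Net.sum_acnt_mul N R i j hij]
      simp
      ring
    rw [ht, Finset.mul_sum, Finset.sum_congr rfl
      (fun p _ => sign_id (x p) y (hx1 p) hy1 (hxp p) hy)]
    simp only [Finset.sum_add_distrib, ← Finset.mul_sum, s1]
    rw [s2 0 1 (by decide), s2 0 2 (by decide), s2 0 3 (by decide), s2 1 2 (by decide),
      s2 1 3 (by decide), s2 2 3 (by decide)]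
    have hyi : ∀ i, (-1 : ℤ) ^ (if b i then 1 else 0 : ℕ) = y i := fun i => rfl
    simp only [hyi]
    clear_value y
    simp only [Fin.sum_univ_four]
    simp
    ring
  · intro b hb
    unfold Net.tcount
    rw [Nat.card_eq_zero]
    left
    constructor
    rintro ⟨p, hp⟩
    have he := N.even_acnt hn R hR p
    have e : (Finset.univ.filter (fun i => b i = true)).card = ∑ i, N.acnt R i p := by
      rw [Finset.card_filter]
      refine Finset.sum_congr rfl fun i _ => ?_
      have := hp i
      rw [Net.onRel_iff] at this
      rcases ha i p with h | h
      · rw [h] at this ⊢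
        rw [if_neg (by rw [← this]; decide)]
      · rw [h] at this ⊢
        rw [if_pos (this.mp rfl)]
    rw [e] at hb
    exact (Nat.not_even_iff_odd.mpr hb) he
end

section
/- A 4-net of order 10 admits no relation whose type is a permutation of (2,2,2,2), no relation whose type is a permutation of (2,2,2,6), and no relation whose type is a permutation of (2,2,4,4). -/
open scoped Classical

theorem key4 (N : Net 4 10) (R : Finset (Finset (Fin (10 ^ 2))))
    (hR : N.IsRelation R) (i : Fin 4) (hi : 0 < N.relType R i) :
    10 + N.relType R i ≤ (Multiset.map (N.relType R) Finset.univ.val).sum := by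
  obtain ⟨l, hl⟩ := Finset.card_pos.mp hi
  obtain ⟨hlR, hlc⟩ := Finset.mem_inter.mp hl
  have h1 : ∀ p ∈ l, ∃ m ∈ R, m ≠ l ∧ p ∈ m := by
    intro p hp
    have he := hR.2 p
    have hm : l ∈ R.filter (fun x => p ∈ x) := Finset.mem_filter.mpr ⟨hlR, hp⟩
    have hpos := Finset.card_pos.mpr ⟨l, hm⟩
    have h2 : 1 < (R.filter (fun x => p ∈ x)).card := by
      obtain ⟨k, hk⟩ := he
      omega
    obtain ⟨m, hm1, hm2⟩ := Finset.exists_mem_ne h2 l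
    rw [Finset.mem_filter] at hm1
    exact ⟨m, hm1.1, hm2, hm1.2⟩
  choose! f hfR hfne hfp using h1
  have hcls : ∀ p ∈ l, ∃ j, j ≠ i ∧ f p ∈ N.classes j := by
    intro p hp
    have := hR.1 (hfR p hp)
    simp only [Net.lineSet, Finset.mem_biUnion, Finset.mem_univ, true_and] at this
    obtain ⟨j, hj⟩ := this
    refine ⟨j, ?_, hj⟩
    rintro rfl
    exact Finset.disjoint_left.mp (N.disjoint_within j _ hj _ hlc (hfne p hp)) (hfp p hp) hp
  have hinj : Set.InjOn f l := by
    intro p hp q hq hpq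
    obtain ⟨j, hji, hj⟩ := hcls p hp
    have h1 := N.one_point j i hji _ hj _ hlc
    refine Finset.card_le_one.mp h1.le p ?_ q ?_
    · exact Finset.mem_inter.mpr ⟨hfp p hp, hp⟩
    · exact Finset.mem_inter.mpr ⟨hpq ▸ hfp q hq, hq⟩
  have hmaps : Set.MapsTo f l
      ((Finset.univ.erase i).biUnion (fun j => R ∩ N.classes j) : Finset _) := by
    intro p hp
    obtain ⟨j, hji, hj⟩ := hcls p hp
    exact Finset.mem_coe.mpr (Finset.mem_biUnion.mpr
      ⟨j, Finset.mem_erase.mpr ⟨hji, Finset.mem_univ _⟩, Finset.mem_inter.mpr ⟨hfR p hp, hj⟩⟩)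
  have h3 := Finset.card_le_card_of_injOn f hmaps hinj
  rw [N.card_line i l hlc] at h3
  have h4 := h3.trans Finset.card_biUnion_le
  have h5 := Finset.sum_erase_add Finset.univ (N.relType R) (Finset.mem_univ i)
  change _ ≤ ∑ j, N.relType R j
  rw [← h5]
  exact Nat.add_le_add_right h4 _

theorem key4' (N : Net 4 10) (R : Finset (Finset (Fin (10 ^ 2))))
    (hR : N.IsRelation R) (s : Multiset ℕ) (a : ℕ) (ha : a ∈ s) (h0 : 0 < a)
    (hs : s.sum < 10 + a) : Multiset.map (N.relType R) Finset.univ.val ≠ s := by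
  rintro rfl
  obtain ⟨i, -, rfl⟩ := Multiset.mem_map.mp ha
  have := key4 N R hR i h0
  omega

/-- A 4-net of order 10 admits no relation whose type is a permutation
of `(2,2,2,2)`, of `(2,2,2,6)`, or of `(2,2,4,4)`. -/
theorem statement4 (N : Net 4 10) (R : Finset (Finset (Fin (10 ^ 2))))
    (hR : N.IsRelation R) :
    Multiset.map (N.relType R) Finset.univ.val ≠ ({2, 2, 2, 2} : Multiset ℕ) ∧
    Multiset.map (N.relType R) Finset.univ.val ≠ ({2, 2, 2, 6} : Multiset ℕ) ∧
    Multiset.map (N.relType R) Finset.univ.val ≠ ({2, 2, 4, 4} : Multiset ℕ) := by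
  exact ⟨key4' N R hR _ 2 (by simp) (by simp) (by simp),
    key4' N R hR _ 6 (by simp) (by simp) (by simp),
    key4' N R hR _ 4 (by simp) (by simp) (by simp)⟩
end

section
/- A 5-net of order 10 admits no relation whose type is a permutation of (2,2,2,2,4). -/
open scoped Classical

/-- A 5-net of order 10 admits no relation whose type is a permutation
of `(2,2,2,2,4)`. -/
theorem statement5 (N : Net 5 10) (R : Finset (Finset (Fin (10 ^ 2))))
    (hR : N.IsRelation R) :
    Multiset.map (N.relType R) Finset.univ.val ≠ ({2, 2, 2, 2, 4} : Multiset ℕ) := by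
  intro h
  have hmem : (4 : ℕ) ∈ Multiset.map (N.relType R) Finset.univ.val := by
    rw [h]; simp
  obtain ⟨i, -, hi⟩ := Multiset.mem_map.1 hmem
  have hsum : ∑ j, N.relType R j = 12 := by
    rw [Finset.sum_eq_multiset_sum, h]; simp
  have hne : (R ∩ N.classes i).Nonempty := by
    rw [← Finset.card_pos]
    have : (R ∩ N.classes i).card = 4 := hi
    omega
  obtain ⟨l, hl⟩ := hne
  obtain ⟨hlR, hli⟩ := Finset.mem_inter.1 hl
  set S := (Finset.univ.erase i).biUnion (fun j => R ∩ N.classes j) with hS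
  have hScard : S.card ≤ 8 := by
    refine Finset.card_biUnion_le.trans ?_
    have h1 := Finset.add_sum_erase Finset.univ (N.relType R) (Finset.mem_univ i)
    have h2 : ∑ j ∈ Finset.univ.erase i, (R ∩ N.classes j).card
        = ∑ j ∈ Finset.univ.erase i, N.relType R j := rfl
    omega
  have hsub : l ⊆ S.biUnion (fun m => l ∩ m) := by
    intro p hp
    have hmemf : l ∈ R.filter (fun m => p ∈ m) := Finset.mem_filter.2 ⟨hlR, hp⟩
    have hev := hR.2 p
    have hpos : 0 < (R.filter (fun m => p ∈ m)).card := Finset.card_pos.2 ⟨l, hmemf⟩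
    have hgt : 1 < (R.filter (fun m => p ∈ m)).card := by
      obtain ⟨c, hc⟩ := hev
      omega
    obtain ⟨m, hm, hml⟩ := Finset.exists_mem_ne hgt l
    obtain ⟨hmR, hpm⟩ := Finset.mem_filter.1 hm
    obtain ⟨j, -, hmj⟩ := Finset.mem_biUnion.1 (hR.1 hmR)
    have hji : j ≠ i := by
      rintro rfl
      exact Finset.disjoint_left.1 (N.disjoint_within j m hmj l hli hml) hpm hp
    refine Finset.mem_biUnion.2 ⟨m, ?_, Finset.mem_inter.2 ⟨hp, hpm⟩⟩
    exact Finset.mem_biUnion.2 ⟨j, Finset.mem_erase.2 ⟨hji, Finset.mem_univ _⟩,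
      Finset.mem_inter.2 ⟨hmR, hmj⟩⟩
  have hc := Finset.card_le_card hsub
  have hb : (S.biUnion (fun m => l ∩ m)).card ≤ S.card * 1 := by
    refine Finset.card_biUnion_le_card_mul _ _ _ ?_
    intro m hm
    obtain ⟨j, hj, hmj⟩ := Finset.mem_biUnion.1 hm
    exact (N.one_point i j (Finset.ne_of_mem_erase hj).symm l hli m
      (Finset.mem_inter.1 hmj).2).le
  rw [N.card_line i l hli] at hc
  omega
end

section
/- Let N be a 6-net of order 10 with parallel classes Π_0,…,Π_5 and let R be a relation on N of type (λ_0,…,λ_5). Then for every index i ∈ {0,…,5} with λ_i ≥ 1, one has Σ_{j≠i} λ_j ≥ 10 and moreover t_{111111} ≤ λ_i · ⌊(Σ_{j≠i} λ_j − 10)/4⌋, where t_{111111} denotes the number of points of weight 6 with respect to R. -/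
open scoped Classical

theorem aux_sum_split (N : Net 6 10) (R : Finset (Finset (Fin (10 ^ 2))))
    (hR : R ⊆ N.lineSet) (f : Finset (Fin (10 ^ 2)) → ℕ) :
    ∑ m ∈ R, f m = ∑ j, ∑ m ∈ R ∩ N.classes j, f m := by
  have h : R = Finset.univ.biUnion (fun j => R ∩ N.classes j) := by
    ext m
    simp only [Finset.mem_biUnion, Finset.mem_univ, true_and, Finset.mem_inter]
    constructor
    · intro hm
      have := hR hm
      simp only [Net.lineSet, Finset.mem_biUnion, Finset.mem_univ, true_and] at this
      obtain ⟨j, hj⟩ := this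
      exact ⟨j, hm, hj⟩
    · rintro ⟨j, hm, _⟩
      exact hm
  conv_lhs => rw [h]
  rw [Finset.sum_biUnion]
  intro a _ b _ hab
  refine Finset.disjoint_left.mpr ?_
  intro m ha hb
  have ha' := (Finset.mem_inter.mp ha).2
  have hb' := (Finset.mem_inter.mp hb).2
  have h1 := N.one_point a b hab m ha' m hb'
  have h2 := N.card_line a m ha'
  rw [Finset.inter_self] at h1
  omega

theorem aux_line_sum (N : Net 6 10) (R : Finset (Finset (Fin (10 ^ 2))))
    (hR : R ⊆ N.lineSet) (i : Fin 6) (l : Finset (Fin (10 ^ 2)))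
    (hl : l ∈ R ∩ N.classes i) :
    ∑ p ∈ l, (R.filter (fun m => p ∈ m)).card
      = 10 + ∑ j ∈ Finset.univ.erase i, N.relType R j := by
  have hl' := (Finset.mem_inter.mp hl).2
  have h1 : ∑ p ∈ l, (R.filter (fun m => p ∈ m)).card = ∑ m ∈ R, (l ∩ m).card := by
    simp only [Finset.card_filter]
    rw [Finset.sum_comm]
    refine Finset.sum_congr rfl fun m _ => ?_
    rw [← Finset.card_filter, Finset.filter_mem_eq_inter]
  rw [h1, aux_sum_split N R hR, ← Finset.add_sum_erase _ _ (Finset.mem_univ i)]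
  congr 1
  · rw [Finset.sum_eq_single_of_mem l hl]
    · rw [Finset.inter_self]; exact N.card_line i l hl'
    · intro m hm hne
      have := N.disjoint_within i l hl' m (Finset.mem_inter.mp hm).2 hne.symm
      rw [Finset.disjoint_iff_inter_eq_empty.mp this, Finset.card_empty]
  · refine Finset.sum_congr rfl fun j hj => ?_
    rw [Net.relType, Finset.card_eq_sum_ones]
    refine Finset.sum_congr rfl fun m hm => ?_
    exact N.one_point i j (Finset.ne_of_mem_erase hj).symm l hl' m (Finset.mem_inter.mp hm).2

theorem aux_full (N : Net 6 10) (R : Finset (Finset (Fin (10 ^ 2))))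
    (hR : R ⊆ N.lineSet) (p : Fin (10 ^ 2)) (hp : ∀ j, N.OnRel R p j) :
    6 ≤ (R.filter (fun m => p ∈ m)).card := by
  rw [Finset.card_filter, aux_sum_split N R hR]
  have : ∑ _j : Fin 6, 1 ≤ ∑ j, ∑ m ∈ R ∩ N.classes j, (if p ∈ m then 1 else 0) := by
    refine Finset.sum_le_sum fun j _ => ?_
    obtain ⟨m, hm, hpm⟩ := hp j
    rw [← Finset.card_filter]
    exact Finset.card_pos.mpr ⟨m, Finset.mem_filter.mpr ⟨hm, hpm⟩⟩
  simpa using this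

theorem aux_line (N : Net 6 10) (R : Finset (Finset (Fin (10 ^ 2))))
    (hR : N.IsRelation R) (i : Fin 6) (l : Finset (Fin (10 ^ 2)))
    (hl : l ∈ R ∩ N.classes i) :
    10 + 4 * (l.filter (fun p => ∀ j, N.OnRel R p j)).card
      ≤ ∑ j ∈ Finset.univ.erase i, N.relType R j := by
  have h := aux_line_sum N R hR.1 i l hl
  have hc := N.card_line i l (Finset.mem_inter.mp hl).2
  have h2 : ∑ p ∈ l, (2 + 4 * (if ∀ j, N.OnRel R p j then 1 else 0))
      ≤ ∑ p ∈ l, (R.filter (fun m => p ∈ m)).card := by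
    refine Finset.sum_le_sum fun p hp => ?_
    split_ifs with hf
    · exact aux_full N R hR.1 p hf
    · have hpos : 0 < (R.filter (fun m => p ∈ m)).card :=
        Finset.card_pos.mpr ⟨l, Finset.mem_filter.mpr ⟨(Finset.mem_inter.mp hl).1, hp⟩⟩
      obtain ⟨r, hr⟩ := hR.2 p
      omega
  rw [Finset.sum_add_distrib, ← Finset.mul_sum, ← Finset.card_filter, Finset.sum_const, hc] at h2
  simp only [smul_eq_mul] at h2
  omega

/-- For a relation `R` on a 6-net of order 10 and any index `i` with
`λ_i ≥ 1`: `Σ_{j≠i} λ_j ≥ 10` and `t_{111111} ≤ λ_i * ⌊(Σ_{j≠i} λ_j - 10)/4⌋`. -/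
theorem statement6 (N : Net 6 10) (R : Finset (Finset (Fin (10 ^ 2))))
    (hR : N.IsRelation R) (i : Fin 6) (hi : 1 ≤ N.relType R i) :
    10 ≤ ∑ j ∈ Finset.univ.erase i, N.relType R j ∧
    N.tcount R (fun _ => true) ≤
      N.relType R i * ((∑ j ∈ Finset.univ.erase i, N.relType R j - 10) / 4) := by
  constructor
  · obtain ⟨l, hl⟩ := Finset.card_pos.mp hi
    have := aux_line N R hR i l hl
    omega
  · have h1 : N.tcount R (fun _ => true)
        = (Finset.univ.filter (fun p => ∀ j, N.OnRel R p j)).card := by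
      rw [Net.tcount, Nat.card_eq_fintype_card, Fintype.card_subtype]
      simp
    rw [h1]
    have h2 : Finset.univ.filter (fun p => ∀ j, N.OnRel R p j) ⊆
        (R ∩ N.classes i).biUnion (fun l => l.filter (fun p => ∀ j, N.OnRel R p j)) := by
      intro p hp
      have hp' := (Finset.mem_filter.mp hp).2
      obtain ⟨l, hl, hpl⟩ := hp' i
      exact Finset.mem_biUnion.mpr ⟨l, hl, Finset.mem_filter.mpr ⟨hpl, hp'⟩⟩
    refine (Finset.card_le_card h2).trans ?_
    refine Finset.card_biUnion_le_card_mul _ _ _ fun l hl => ?_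
    have := aux_line N R hR i l hl
    omega
end

section
/- Let N = (P,L) be a 4-net of order 10 and let R be a relation on N of type (4,4,4,4). Then: (a) every line ℓ ∈ R contains exactly one point of weight 4 and nine points of weight 2; (b) every line ℓ ∈ L ∖ R contains exactly six points of weight 2 and four points of weight 0; (c) there are exactly four points of weight 4, and no two distinct points of weight 4 lie on a common line of L. -/
open scoped Classical

namespace Net

theorem aux_disj (N : Net 4 10) : ∀ i j, i ≠ j → Disjoint (N.classes i) (N.classes j) := by
  intro i j hij
  rw [Finset.disjoint_left]
  intro a ha hb
  have h1 := N.one_point i j hij a ha a hb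
  rw [Finset.inter_self, N.card_line i a ha] at h1
  omega

theorem aux_decomp (N : Net 4 10) (R : Finset (Finset (Fin (10 ^ 2))))
    (hR : R ⊆ N.lineSet) (f : Finset (Fin (10 ^ 2)) → ℕ) :
    ∑ m ∈ R, f m = ∑ i, ∑ m ∈ R ∩ N.classes i, f m := by
  have h : R = Finset.univ.biUnion (fun i => R ∩ N.classes i) := by
    ext m
    constructor
    · intro hm
      have h2 := hR hm
      simp only [lineSet, Finset.mem_biUnion, Finset.mem_univ, true_and] at h2
      obtain ⟨i, hi⟩ := h2
      simp only [Finset.mem_biUnion, Finset.mem_univ, true_and, Finset.mem_inter]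
      exact ⟨i, hm, hi⟩
    · intro hm
      simp only [Finset.mem_biUnion, Finset.mem_univ, true_and, Finset.mem_inter] at hm
      exact hm.choose_spec.1
  conv_lhs => rw [h]
  rw [Finset.sum_biUnion]
  intro i _ j _ hij
  exact Finset.disjoint_of_subset_left Finset.inter_subset_right
    (Finset.disjoint_of_subset_right Finset.inter_subset_right (aux_disj N i j hij))

theorem aux_weight (N : Net 4 10) (R : Finset (Finset (Fin (10 ^ 2))))
    (hR : R ⊆ N.lineSet) (p : Fin (10 ^ 2)) :
    weight R p = ∑ i, ((R ∩ N.classes i).filter (fun m => p ∈ m)).card := by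
  unfold weight
  simp only [Finset.card_filter]
  exact aux_decomp N R hR _

theorem aux_le_one (N : Net 4 10) (R : Finset (Finset (Fin (10 ^ 2)))) (p : Fin (10 ^ 2)) (i) :
    ((R ∩ N.classes i).filter (fun m => p ∈ m)).card ≤ 1 := by
  rw [Finset.card_le_one]
  intro a ha b hb
  simp only [Finset.mem_filter, Finset.mem_inter] at ha hb
  by_contra hab
  exact Finset.disjoint_left.1 (N.disjoint_within i a ha.1.2 b hb.1.2 hab) ha.2 hb.2

theorem aux_le_four (N : Net 4 10) (R : Finset (Finset (Fin (10 ^ 2))))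
    (hR : R ⊆ N.lineSet) (p : Fin (10 ^ 2)) : weight R p ≤ 4 := by
  rw [aux_weight N R hR, Fin.sum_univ_four]
  have h := aux_le_one N R p
  have := h 0
  have := h 1
  have := h 2
  have := h 3
  omega

theorem aux_le_three (N : Net 4 10) (R : Finset (Finset (Fin (10 ^ 2))))
    (hR : R ⊆ N.lineSet) (p : Fin (10 ^ 2)) (l) (hl : l ∈ N.lineSet) (hlR : l ∉ R)
    (hp : p ∈ l) : weight R p ≤ 3 := by
  simp only [lineSet, Finset.mem_biUnion, Finset.mem_univ, true_and] at hl
  obtain ⟨i, hi⟩ := hl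
  have h0 : ((R ∩ N.classes i).filter (fun m => p ∈ m)).card = 0 := by
    rw [Finset.card_eq_zero, Finset.filter_eq_empty_iff]
    intro m hm hpm
    rw [Finset.mem_inter] at hm
    have hne : m ≠ l := fun h => hlR (h ▸ hm.1)
    exact Finset.disjoint_left.1 (N.disjoint_within i m hm.2 l hi hne) hpm hp
  rw [aux_weight N R hR, ← Finset.add_sum_erase _ _ (Finset.mem_univ i), h0, zero_add]
  refine (Finset.sum_le_card_nsmul _ _ 1 (fun j _ => aux_le_one N R p j)).trans ?_
  rw [Finset.card_erase_of_mem (Finset.mem_univ i)]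
  simp

theorem aux_sum (N : Net 4 10) (R : Finset (Finset (Fin (10 ^ 2))))
    (hR : R ⊆ N.lineSet) (htype : ∀ i, N.relType R i = 4) (l) (hl : l ∈ N.lineSet) :
    ∑ p ∈ l, weight R p = (if l ∈ R then 10 else 0) + 12 := by
  simp only [lineSet, Finset.mem_biUnion, Finset.mem_univ, true_and] at hl
  obtain ⟨i, hi⟩ := hl
  have h1 : ∑ p ∈ l, weight R p = ∑ m ∈ R, (l ∩ m).card := by
    unfold weight
    simp only [Finset.card_filter]
    rw [Finset.sum_comm]
    refine Finset.sum_congr rfl fun m _ => ?_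
    rw [← Finset.card_filter, Finset.filter_mem_eq_inter]
  rw [h1, aux_decomp N R hR, ← Finset.add_sum_erase _ _ (Finset.mem_univ i)]
  congr 1
  · have h2 : ∀ m ∈ R ∩ N.classes i, (l ∩ m).card = if m = l then 10 else 0 := by
      intro m hm
      rw [Finset.mem_inter] at hm
      split_ifs with h
      · rw [h, Finset.inter_self, N.card_line i l hi]
      · rw [Finset.card_eq_zero, ← Finset.disjoint_iff_inter_eq_empty]
        exact N.disjoint_within i l hi m hm.2 (Ne.symm h)
    rw [Finset.sum_congr rfl h2, Finset.sum_ite_eq']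
    simp [hi]
  · have h3 : ∀ j ∈ Finset.univ.erase i, ∑ m ∈ R ∩ N.classes j, (l ∩ m).card = 4 := by
      intro j hj
      have hji := Finset.ne_of_mem_erase hj
      rw [Finset.sum_congr rfl (fun m hm =>
        N.one_point i j hji.symm l hi m (Finset.mem_inter.1 hm).2)]
      rw [Finset.sum_const, smul_eq_mul, mul_one]
      exact htype j
    rw [Finset.sum_congr rfl h3, Finset.sum_const, Finset.card_erase_of_mem (Finset.mem_univ i)]
    simp

theorem aux_count (s : Finset (Fin (10 ^ 2))) (w : Fin (10 ^ 2) → ℕ)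
    (h : ∀ p ∈ s, w p = 0 ∨ w p = 2 ∨ w p = 4) :
    s.card = (s.filter (fun p => w p = 0)).card + (s.filter (fun p => w p = 2)).card
      + (s.filter (fun p => w p = 4)).card ∧
    ∑ p ∈ s, w p = 2 * (s.filter (fun p => w p = 2)).card
      + 4 * (s.filter (fun p => w p = 4)).card := by
  simp only [Finset.card_filter, Finset.mul_sum, ← Finset.sum_add_distrib]
  constructor
  · rw [Finset.card_eq_sum_ones]
    refine Finset.sum_congr rfl fun p hp => ?_
    rcases h p hp with h | h | h <;> simp [h]
  · refine Finset.sum_congr rfl fun p hp => ?_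
    rcases h p hp with h | h | h <;> simp [h]

end Net

/-- For a relation `R` of type `(4,4,4,4)` on a 4-net of order 10:
(a) every line of `R` contains exactly one point of weight 4 and nine of weight 2;
(b) every line of the net not in `R` contains exactly six points of weight 2 and
four of weight 0; (c) there are exactly four points of weight 4, and no two distinct
points of weight 4 lie on a common line. -/
theorem statement7 (N : Net 4 10) (R : Finset (Finset (Fin (10 ^ 2))))
    (hR : N.IsRelation R) (htype : ∀ i, N.relType R i = 4) :
    (∀ ℓ ∈ R,
      (ℓ.filter (fun p => Net.weight R p = 4)).card = 1 ∧
      (ℓ.filter (fun p => Net.weight R p = 2)).card = 9) ∧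
    (∀ ℓ ∈ N.lineSet, ℓ ∉ R →
      (ℓ.filter (fun p => Net.weight R p = 2)).card = 6 ∧
      (ℓ.filter (fun p => Net.weight R p = 0)).card = 4) ∧
    Nat.card {p : Fin (10 ^ 2) // Net.weight R p = 4} = 4 ∧
    (∀ p q : Fin (10 ^ 2), Net.weight R p = 4 → Net.weight R q = 4 → p ≠ q →
      ∀ ℓ ∈ N.lineSet, ¬ (p ∈ ℓ ∧ q ∈ ℓ)) := by
  obtain ⟨hs, hev⟩ := hR
  have hw : ∀ p, Net.weight R p = 0 ∨ Net.weight R p = 2 ∨ Net.weight R p = 4 := by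
    intro p
    have h1 := Net.aux_le_four N R hs p
    have h2 : Even (Net.weight R p) := hev p
    obtain ⟨c, hc⟩ := h2
    omega
  have hcard : ∀ ℓ ∈ N.lineSet, ℓ.card = 10 := by
    intro ℓ hl
    simp only [Net.lineSet, Finset.mem_biUnion, Finset.mem_univ, true_and] at hl
    obtain ⟨i, hi⟩ := hl
    exact N.card_line i ℓ hi
  have ha : ∀ ℓ ∈ R,
      (ℓ.filter (fun p => Net.weight R p = 4)).card = 1 ∧
      (ℓ.filter (fun p => Net.weight R p = 2)).card = 9 := by
    intro ℓ hl
    have h1 := Net.aux_sum N R hs htype ℓ (hs hl)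
    rw [if_pos hl] at h1
    obtain ⟨h2, h3⟩ := Net.aux_count ℓ (Net.weight R) (fun p _ => hw p)
    rw [hcard ℓ (hs hl)] at h2
    have h4 : (ℓ.filter (fun p => Net.weight R p = 0)).card = 0 := by
      rw [Finset.card_eq_zero, Finset.filter_eq_empty_iff]
      intro p hp h0
      unfold Net.weight at h0
      rw [Finset.card_eq_zero, Finset.filter_eq_empty_iff] at h0
      exact h0 hl hp
    omega
  refine ⟨ha, ?_, ?_, ?_⟩
  · intro ℓ hl hlR
    have h1 := Net.aux_sum N R hs htype ℓ hl
    rw [if_neg hlR] at h1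
    obtain ⟨h2, h3⟩ := Net.aux_count ℓ (Net.weight R) (fun p _ => hw p)
    rw [hcard ℓ hl] at h2
    have h4 : (ℓ.filter (fun p => Net.weight R p = 4)).card = 0 := by
      rw [Finset.card_eq_zero, Finset.filter_eq_empty_iff]
      intro p hp h0
      have := Net.aux_le_three N R hs p ℓ hl hlR hp
      omega
    omega
  · rw [Nat.card_eq_fintype_card, Fintype.card_subtype]
    have hRc : R.card = 16 := by
      rw [Finset.card_eq_sum_ones, Net.aux_decomp N R hs]
      simp only [← Finset.card_eq_sum_ones]
      have h : ∀ i ∈ Finset.univ, (R ∩ N.classes i).card = 4 := fun i _ => htype i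
      rw [Finset.sum_congr rfl h]
      simp
    have h1 := Finset.sum_card_bipartiteAbove_eq_sum_card_bipartiteBelow
      (s := R) (t := Finset.univ.filter (fun p => Net.weight R p = 4)) (fun ℓ p => p ∈ ℓ)
    have hA : ∀ ℓ ∈ R, (Finset.bipartiteAbove (fun ℓ p => p ∈ ℓ)
        (Finset.univ.filter (fun p => Net.weight R p = 4)) ℓ).card = 1 := by
      intro ℓ hl
      rw [← (ha ℓ hl).1]
      congr 1
      ext p
      simp [Finset.bipartiteAbove, and_comm]
    have hB : ∀ p ∈ Finset.univ.filter (fun p => Net.weight R p = 4),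
        (Finset.bipartiteBelow (fun ℓ p => p ∈ ℓ) R p).card = 4 := by
      intro p hp
      exact (Finset.mem_filter.1 hp).2
    rw [Finset.sum_congr rfl hA, Finset.sum_congr rfl hB] at h1
    simp only [Finset.sum_const, smul_eq_mul, hRc] at h1
    omega
  · rintro p q hp hq hpq ℓ hl ⟨hpl, hql⟩
    by_cases hlR : ℓ ∈ R
    · exact hpq (Finset.card_le_one.1 (ha ℓ hlR).1.le p (Finset.mem_filter.2 ⟨hpl, hp⟩)
        q (Finset.mem_filter.2 ⟨hql, hq⟩))
    · have := Net.aux_le_three N R hs p ℓ hl hlR hpl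
      omega
end

section
/- Let N be a 5-net of order 10 with parallel classes Π_0,…,Π_4 and let R be an odd relation on N with |R ∩ Π_0| = |R ∩ Π_1| = 4 and |R ∩ Π_2| = |R ∩ Π_3| = |R ∩ Π_4| = 2. Then t_{10000} = t_{01000} = 24, t_{00100} = t_{00010} = t_{00001} = 12, t_{11100} = t_{11010} = t_{11001} = t_{11111} = 4, and t_b = 0 for every other b ∈ {0,1}^5. -/
open scoped Classical

namespace Net

/-- number of lines of `R ∩ Π_i` through `p` -/
noncomputable def xi {k n : ℕ} (N : Net k n) (R : Finset (Finset (Fin (n ^ 2)))) (i : Fin k)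
    (p : Fin (n ^ 2)) : ℕ := ∑ ℓ ∈ R ∩ N.classes i, if p ∈ ℓ then 1 else 0

theorem xi_eq {k n : ℕ} (N : Net k n) (R : Finset (Finset (Fin (n ^ 2)))) (i : Fin k)
    (p : Fin (n ^ 2)) : N.xi R i p = (decide (N.OnRel R p i)).toNat := by
  unfold xi
  by_cases h : N.OnRel R p i
  · have h' := h
    obtain ⟨l, hl, hp⟩ := h
    rw [Finset.sum_eq_single l]
    · simp [h', hp]
    · intro l' hl' hne
      rw [if_neg]
      intro hp'
      rw [Finset.mem_inter] at hl hl'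
      exact Finset.disjoint_left.1 (N.disjoint_within i l' hl'.2 l hl.2 hne) hp' hp
    · intro h; exact absurd hl h
  · simp only [h, decide_false, Bool.toNat_false]
    apply Finset.sum_eq_zero
    intro l hl
    rw [if_neg]
    intro hp
    exact h ⟨l, hl, hp⟩

theorem sum_xi {k n : ℕ} (N : Net k n) (R : Finset (Finset (Fin (n ^ 2)))) (i : Fin k) :
    ∑ p, N.xi R i p = N.relType R i * n := by
  unfold xi relType
  rw [Finset.sum_comm, Finset.sum_const_nat]
  intro l hl
  rw [Finset.mem_inter] at hl
  simp [N.card_line i l hl.2]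

theorem sum_xi_mul {k n : ℕ} (N : Net k n) (R : Finset (Finset (Fin (n ^ 2)))) (i j : Fin k)
    (hij : i ≠ j) :
    ∑ p, N.xi R i p * N.xi R j p = N.relType R i * N.relType R j := by
  unfold xi relType
  simp_rw [Finset.sum_mul_sum]
  rw [Finset.sum_comm, Finset.sum_const_nat]
  intro l hl
  rw [Finset.sum_comm, ← mul_one (Finset.card _), Finset.sum_const_nat]
  intro l' hl'
  rw [Finset.mem_inter] at hl hl'
  rw [← N.one_point i j hij l hl.2 l' hl'.2, Finset.card_eq_sum_ones, ← Finset.sum_filter_add_sum_filter_not Finset.univ (fun p => p ∈ l ∩ l')]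
  rw [Finset.sum_congr rfl (g := fun _ => 1), Finset.sum_eq_zero (s := Finset.filter (fun p => ¬ _) _)]
  · rw [add_zero]
    congr 1
    ext p; simp
  · intro p hp
    simp only [Finset.mem_filter, Finset.mem_inter, not_and] at hp
    by_cases h : p ∈ l
    · simp [hp.2 h]
    · simp [h]
  · intro p hp
    simp only [Finset.mem_filter, Finset.mem_inter] at hp
    simp [hp.2, N.one_point i j hij l hl.2 l' hl'.2]

theorem odd_xi (N : Net 5 10) (R : Finset (Finset (Fin (10 ^ 2))))
    (hR : N.IsOddRelation R) (p : Fin (10 ^ 2)) : Odd (∑ i, N.xi R i p) := by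
  convert hR.2 p using 1
  have hRe : R = Finset.univ.biUnion (fun i => R ∩ N.classes i) := by
    ext l
    have := @hR.1 l
    simp only [lineSet, Finset.mem_biUnion, Finset.mem_univ, true_and, Finset.mem_inter] at this ⊢
    constructor
    · intro h; obtain ⟨i, hi⟩ := this h; exact ⟨i, h, hi⟩
    · rintro ⟨i, h, _⟩; exact h
  rw [Finset.card_filter]
  conv_rhs => rw [hRe]
  rw [Finset.sum_biUnion]
  · rfl
  · intro i _ j _ hij
    rw [Function.onFun, Finset.disjoint_left]
    intro l h1 h2
    rw [Finset.mem_inter] at h1 h2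
    have h3 := N.one_point i j hij l h1.2 l h2.2
    rw [Finset.inter_self, N.card_line i l h1.2] at h3
    omega

/-- the pattern of a point -/
noncomputable def pat (N : Net 5 10) (R : Finset (Finset (Fin (10 ^ 2)))) (p : Fin (10 ^ 2)) :
    Bool × Bool × Bool × Bool × Bool :=
  (decide (N.OnRel R p 0), decide (N.OnRel R p 1), decide (N.OnRel R p 2),
    decide (N.OnRel R p 3), decide (N.OnRel R p 4))

/-- pattern counts -/
noncomputable def tp (N : Net 5 10) (R : Finset (Finset (Fin (10 ^ 2)))) (a b c d e : Bool) : ℕ :=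
  (Finset.univ.filter (fun p => N.pat R p = (a, b, c, d, e))).card

theorem tcount_eq_s12 (N : Net 5 10) (R : Finset (Finset (Fin (10 ^ 2)))) (a b c d e : Bool) :
    N.tcount R ![a, b, c, d, e] = N.tp R a b c d e := by
  unfold tcount tp
  rw [Nat.card_eq_fintype_card, Fintype.card_subtype]
  congr 1
  ext p
  simp only [Finset.mem_filter, Finset.mem_univ, true_and, pat, Prod.mk.injEq]
  constructor
  · intro h
    have h0 := h 0
    have h1 := h 1
    have h2 := h 2
    have h3 := h 3
    have h4 := h 4
    simp at h0 h1 h2 h3 h4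
    simp [h0, h1, h2, h3, h4]
  · rintro ⟨rfl, rfl, rfl, rfl, rfl⟩ i
    fin_cases i <;> simp

theorem sum_pat (N : Net 5 10) (R : Finset (Finset (Fin (10 ^ 2))))
    (g : Bool × Bool × Bool × Bool × Bool → ℕ) :
    ∑ p, g (N.pat R p) = ∑ a, ∑ b, ∑ c, ∑ d, ∑ e, N.tp R a b c d e * g (a, b, c, d, e) := by
  rw [← Finset.sum_fiberwise Finset.univ (N.pat R)]
  simp only [Fintype.sum_prod_type]
  refine Finset.sum_congr rfl fun a _ => Finset.sum_congr rfl fun b _ =>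
    Finset.sum_congr rfl fun c _ => Finset.sum_congr rfl fun d _ => Finset.sum_congr rfl fun e _ => ?_
  unfold tp
  apply Finset.sum_const_nat
  intro p hp
  rw [(Finset.mem_filter.1 hp).2]

theorem tp_even (N : Net 5 10) (R : Finset (Finset (Fin (10 ^ 2))))
    (hR : N.IsOddRelation R) (a b c d e : Bool)
    (h : (a.toNat + b.toNat + c.toNat + d.toNat + e.toNat) % 2 = 0) : N.tp R a b c d e = 0 := by
  unfold tp
  rw [Finset.card_eq_zero, Finset.filter_eq_empty_iff]
  intro p _ hp
  have := N.odd_xi R hR p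
  simp only [Fin.sum_univ_five, xi_eq] at this
  simp only [pat, Prod.mk.injEq] at hp
  obtain ⟨r0, r1, r2, r3, r4⟩ := hp
  rw [r0, r1, r2, r3, r4, Nat.odd_iff] at this
  omega

end Net

set_option maxHeartbeats 4000000 in
/-- for an odd relation of type `(4,4,2,2,2)` on a 5-net of order 10,
the point-type counts are `t_{10000} = t_{01000} = 24`,
`t_{00100} = t_{00010} = t_{00001} = 12`,
`t_{11100} = t_{11010} = t_{11001} = t_{11111} = 4`, and `t_b = 0` otherwise. -/
theorem statement12 (N : Net 5 10) (R : Finset (Finset (Fin (10 ^ 2))))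
    (hR : N.IsOddRelation R)
    (h0 : N.relType R 0 = 4) (h1 : N.relType R 1 = 4)
    (h2 : N.relType R 2 = 2) (h3 : N.relType R 3 = 2) (h4 : N.relType R 4 = 2) :
    N.tcount R ![true, false, false, false, false] = 24 ∧
    N.tcount R ![false, true, false, false, false] = 24 ∧
    N.tcount R ![false, false, true, false, false] = 12 ∧
    N.tcount R ![false, false, false, true, false] = 12 ∧
    N.tcount R ![false, false, false, false, true] = 12 ∧
    N.tcount R ![true, true, true, false, false] = 4 ∧
    N.tcount R ![true, true, false, true, false] = 4 ∧
    N.tcount R ![true, true, false, false, true] = 4 ∧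
    N.tcount R ![true, true, true, true, true] = 4 ∧
    (∀ b : Fin 5 → Bool,
      b ≠ ![true, false, false, false, false] →
      b ≠ ![false, true, false, false, false] →
      b ≠ ![false, false, true, false, false] →
      b ≠ ![false, false, false, true, false] →
      b ≠ ![false, false, false, false, true] →
      b ≠ ![true, true, true, false, false] →
      b ≠ ![true, true, false, true, false] →
      b ≠ ![true, true, false, false, true] →
      b ≠ ![true, true, true, true, true] →
      N.tcount R b = 0) := by
  have hT := N.sum_pat R (fun _ => 1)
  have s0 := N.sum_xi R 0
  have u0 := N.sum_pat R (fun q => (q.1).toNat)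
  simp only [Net.xi_eq] at s0
  simp only [Net.pat] at u0
  rw [s0, h0] at u0
  have s1 := N.sum_xi R 1
  have u1 := N.sum_pat R (fun q => (q.2.1).toNat)
  simp only [Net.xi_eq] at s1
  simp only [Net.pat] at u1
  rw [s1, h1] at u1
  have s2 := N.sum_xi R 2
  have u2 := N.sum_pat R (fun q => (q.2.2.1).toNat)
  simp only [Net.xi_eq] at s2
  simp only [Net.pat] at u2
  rw [s2, h2] at u2
  have s3 := N.sum_xi R 3
  have u3 := N.sum_pat R (fun q => (q.2.2.2.1).toNat)
  simp only [Net.xi_eq] at s3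
  simp only [Net.pat] at u3
  rw [s3, h3] at u3
  have s4 := N.sum_xi R 4
  have u4 := N.sum_pat R (fun q => (q.2.2.2.2).toNat)
  simp only [Net.xi_eq] at s4
  simp only [Net.pat] at u4
  rw [s4, h4] at u4
  have s01 := N.sum_xi_mul R 0 1 (by decide)
  have u01 := N.sum_pat R (fun q => (q.1).toNat * (q.2.1).toNat)
  simp only [Net.xi_eq] at s01
  simp only [Net.pat] at u01
  rw [s01, h0, h1] at u01
  have s02 := N.sum_xi_mul R 0 2 (by decide)
  have u02 := N.sum_pat R (fun q => (q.1).toNat * (q.2.2.1).toNat)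
  simp only [Net.xi_eq] at s02
  simp only [Net.pat] at u02
  rw [s02, h0, h2] at u02
  have s03 := N.sum_xi_mul R 0 3 (by decide)
  have u03 := N.sum_pat R (fun q => (q.1).toNat * (q.2.2.2.1).toNat)
  simp only [Net.xi_eq] at s03
  simp only [Net.pat] at u03
  rw [s03, h0, h3] at u03
  have s04 := N.sum_xi_mul R 0 4 (by decide)
  have u04 := N.sum_pat R (fun q => (q.1).toNat * (q.2.2.2.2).toNat)
  simp only [Net.xi_eq] at s04
  simp only [Net.pat] at u04
  rw [s04, h0, h4] at u04
  have s12 := N.sum_xi_mul R 1 2 (by decide)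
  have u12 := N.sum_pat R (fun q => (q.2.1).toNat * (q.2.2.1).toNat)
  simp only [Net.xi_eq] at s12
  simp only [Net.pat] at u12
  rw [s12, h1, h2] at u12
  have s13 := N.sum_xi_mul R 1 3 (by decide)
  have u13 := N.sum_pat R (fun q => (q.2.1).toNat * (q.2.2.2.1).toNat)
  simp only [Net.xi_eq] at s13
  simp only [Net.pat] at u13
  rw [s13, h1, h3] at u13
  have s14 := N.sum_xi_mul R 1 4 (by decide)
  have u14 := N.sum_pat R (fun q => (q.2.1).toNat * (q.2.2.2.2).toNat)
  simp only [Net.xi_eq] at s14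
  simp only [Net.pat] at u14
  rw [s14, h1, h4] at u14
  have s23 := N.sum_xi_mul R 2 3 (by decide)
  have u23 := N.sum_pat R (fun q => (q.2.2.1).toNat * (q.2.2.2.1).toNat)
  simp only [Net.xi_eq] at s23
  simp only [Net.pat] at u23
  rw [s23, h2, h3] at u23
  have s24 := N.sum_xi_mul R 2 4 (by decide)
  have u24 := N.sum_pat R (fun q => (q.2.2.1).toNat * (q.2.2.2.2).toNat)
  simp only [Net.xi_eq] at s24
  simp only [Net.pat] at u24
  rw [s24, h2, h4] at u24
  have s34 := N.sum_xi_mul R 3 4 (by decide)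
  have u34 := N.sum_pat R (fun q => (q.2.2.2.1).toNat * (q.2.2.2.2).toNat)
  simp only [Net.xi_eq] at s34
  simp only [Net.pat] at u34
  rw [s34, h3, h4] at u34
  have zttttf := N.tp_even R hR true true true true false (by decide)
  have ztttft := N.tp_even R hR true true true false true (by decide)
  have zttftt := N.tp_even R hR true true false true true (by decide)
  have zttfff := N.tp_even R hR true true false false false (by decide)
  have ztfttt := N.tp_even R hR true false true true true (by decide)
  have ztftff := N.tp_even R hR true false true false false (by decide)
  have ztfftf := N.tp_even R hR true false false true false (by decide)
  have ztffft := N.tp_even R hR true false false false true (by decide)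
  have zftttt := N.tp_even R hR false true true true true (by decide)
  have zfttff := N.tp_even R hR false true true false false (by decide)
  have zftftf := N.tp_even R hR false true false true false (by decide)
  have zftfft := N.tp_even R hR false true false false true (by decide)
  have zffttf := N.tp_even R hR false false true true false (by decide)
  have zfftft := N.tp_even R hR false false true false true (by decide)
  have zffftt := N.tp_even R hR false false false true true (by decide)
  have zfffff := N.tp_even R hR false false false false false (by decide)
  simp only [Fintype.sum_bool, zttttf, ztttft, zttftt, zttfff, ztfttt, ztftff, ztfftf, ztffft, zftttt, zfttff, zftftf, zftfft, zffttf, zfftft, zffftt, zfffff, Bool.toNat_true, Bool.toNat_false, mul_one, mul_zero,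
    add_zero, zero_add, Finset.sum_const, Finset.card_univ, Fintype.card_fin, smul_eq_mul] at hT u0 u1 u2 u3 u4 u01 u02 u03 u04 u12 u13 u14 u23 u24 u34
  clear s34 s24 s23 s14 s13 s12 s04 s03 s02 s01 s4 s3 s2 s1 s0
  have key : N.tp R true true true true true = 4 ∧
    N.tp R true true true false false = 4 ∧
    N.tp R true true false true false = 4 ∧
    N.tp R true true false false true = 4 ∧
    N.tp R true false true true false = 0 ∧
    N.tp R true false true false true = 0 ∧
    N.tp R true false false true true = 0 ∧
    N.tp R true false false false false = 24 ∧
    N.tp R false true true true false = 0 ∧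
    N.tp R false true true false true = 0 ∧
    N.tp R false true false true true = 0 ∧
    N.tp R false true false false false = 24 ∧
    N.tp R false false true true true = 0 ∧
    N.tp R false false true false false = 12 ∧
    N.tp R false false false true false = 12 ∧
    N.tp R false false false false true = 12 := by
    clear hR h0 h1 h2 h3 h4 zttttf ztttft zttftt zttfff ztfttt ztftff ztfftf ztffft zftttt zfttff zftftf zftfft zffttf zfftft zffftt zfffff
    generalize N.tp R true true true true true = y0 at *
    generalize N.tp R true true true false false = y1 at *
    generalize N.tp R true true false true false = y2 at *
    generalize N.tp R true true false false true = y3 at *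
    generalize N.tp R true false true true false = y4 at *
    generalize N.tp R true false true false true = y5 at *
    generalize N.tp R true false false true true = y6 at *
    generalize N.tp R true false false false false = y7 at *
    generalize N.tp R false true true true false = y8 at *
    generalize N.tp R false true true false true = y9 at *
    generalize N.tp R false true false true true = y10 at *
    generalize N.tp R false true false false false = y11 at *
    generalize N.tp R false false true true true = y12 at *
    generalize N.tp R false false true false false = y13 at *
    generalize N.tp R false false false true false = y14 at *
    generalize N.tp R false false false false true = y15 at *
    refine ⟨?_, ?_, ?_, ?_, ?_, ?_, ?_, ?_, ?_, ?_, ?_, ?_, ?_, ?_, ?_, ?_⟩ <;> omega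
  clear hT u0 u1 u2 u3 u4 u01 u02 u03 u04 u12 u13 u14 u23 u24 u34
  obtain ⟨k0, k1, k2, k3, k4, k5, k6, k7, k8, k9, k10, k11, k12, k13, k14, k15⟩ := key
  simp only [Net.tcount_eq_s12]
  refine ⟨by assumption, by assumption, by assumption, by assumption, by assumption, by assumption,
    by assumption, by assumption, by assumption, ?_⟩
  intro b
  have hb : b = ![b 0, b 1, b 2, b 3, b 4] := by
    ext i
    fin_cases i <;> rfl
  rw [hb]
  generalize b 0 = b0
  generalize b 1 = b1
  generalize b 2 = b2
  generalize b 3 = b3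
  generalize b 4 = b4
  rw [Net.tcount_eq_s12]
  intro g0 g1 g2 g3 g4 g5 g6 g7 g8
  cases b0 <;> cases b1 <;> cases b2 <;> cases b3 <;> cases b4 <;>
    first
    | assumption
    | exact absurd rfl (by assumption)
end

section
/- Let N be a 5-net of order 10 with parallel classes Π_0,…,Π_4 and let R be an odd relation on N with |R ∩ Π_0| = |R ∩ Π_1| = 4 and |R ∩ Π_2| = |R ∩ Π_3| = |R ∩ Π_4| = 2 (lines in R are called relational, others non-relational). Then: (i) every point lying on a relational line of exactly one of Π_0, Π_1 lies on no relational line of Π_2, Π_3 or Π_4 (so has weight 1); (ii) for every relational line ℓ of Π_0, the four points of ℓ that lie on relational lines of Π_1 consist of one point of weight 5, which lies on relational lines of all of Π_2, Π_3, Π_4, and three points of weight 3, each lying on a relational line of exactly one of Π_2, Π_3, Π_4, with each of Π_2, Π_3, Π_4 accounting for exactly one of these three points; the same holds with the roles of Π_0 and Π_1 exchanged; (iii) every point lying on no relational line of Π_0 and no relational line of Π_1 lies on exactly one relational line of Π_2 ∪ Π_3 ∪ Π_4 (so has weight 1), and for every non-relational line ℓ of Π_0 and each i ∈ {2,3,4},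 exactly two of the six points of ℓ lying on non-relational lines of Π_1 lie on a relational line of Π_i; the same holds with the roles of Π_0 and Π_1 exchanged. -/
open scoped Classical

namespace Net

theorem onRel_iff_of_mem {k n : ℕ} (N : Net k n) (R : Finset (Finset (Fin (n ^ 2))))
    {a : Fin k} {ℓ : Finset (Fin (n ^ 2))} (hℓ : ℓ ∈ N.classes a) {p : Fin (n ^ 2)} (hp : p ∈ ℓ) :
    N.OnRel R p a ↔ ℓ ∈ R := by
  constructor
  · rintro ⟨m, hm, hpm⟩
    rw [Finset.mem_inter] at hm
    by_cases h : m = ℓ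
    · exact h ▸ hm.1
    · exact absurd hp (Finset.disjoint_left.1 (N.disjoint_within a m hm.2 ℓ hℓ h) hpm)
  · intro h
    exact ⟨ℓ, Finset.mem_inter.2 ⟨h, hℓ⟩, hp⟩

theorem card_filter_onRel {k n : ℕ} (N : Net k n) (R : Finset (Finset (Fin (n ^ 2))))
    {a i : Fin k} (hai : a ≠ i) {ℓ : Finset (Fin (n ^ 2))} (hℓ : ℓ ∈ N.classes a) :
    (ℓ.filter (fun p => N.OnRel R p i)).card = N.relType R i := by
  have h1 : ℓ.filter (fun p => N.OnRel R p i) = (R ∩ N.classes i).biUnion (fun m => ℓ ∩ m) := by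
    ext p
    rw [Finset.mem_filter, Finset.mem_biUnion]
    constructor
    · rintro ⟨hp, m, hm, hpm⟩
      exact ⟨m, hm, Finset.mem_inter.2 ⟨hp, hpm⟩⟩
    · rintro ⟨m, hm, hpm⟩
      exact ⟨(Finset.mem_inter.1 hpm).1, m, hm, (Finset.mem_inter.1 hpm).2⟩
  rw [h1, Finset.card_biUnion]
  · rw [Finset.sum_congr rfl (fun m hm => N.one_point a i hai ℓ hℓ m (Finset.mem_inter.1 hm).2)]
    simp [relType]
  · intro m hm m' hm' hne
    exact (N.disjoint_within i m (Finset.mem_inter.1 hm).2 m' (Finset.mem_inter.1 hm').2 hne).mono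
      Finset.inter_subset_right Finset.inter_subset_right

theorem exists_line {k n : ℕ} (N : Net k n) (i : Fin k) (p : Fin (n ^ 2)) :
    ∃ m ∈ N.classes i, p ∈ m := by
  have h : (N.classes i).biUnion id = Finset.univ := by
    rw [← Finset.card_eq_iff_eq_univ, Finset.card_biUnion]
    · rw [Finset.sum_congr rfl (fun m hm => (N.card_line i m hm : (id m).card = n))]
      rw [Finset.sum_const, N.card_classes, Fintype.card_fin, smul_eq_mul, pow_two]
    · intro m hm m' hm' hne
      exact N.disjoint_within i m hm m' hm' hne
  have hp : p ∈ (N.classes i).biUnion id := h ▸ Finset.mem_univ p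
  simpa using hp

theorem nonrel_iff {k n : ℕ} (N : Net k n) (R : Finset (Finset (Fin (n ^ 2))))
    (i : Fin k) (p : Fin (n ^ 2)) :
    (∃ m ∈ N.classes i, m ∉ R ∧ p ∈ m) ↔ ¬ N.OnRel R p i := by
  constructor
  · rintro ⟨m, hm, hmR, hp⟩ h
    exact hmR ((N.onRel_iff_of_mem R hm hp).1 h)
  · intro h
    obtain ⟨m, hm, hp⟩ := N.exists_line i p
    exact ⟨m, hm, fun hR => h ((N.onRel_iff_of_mem R hm hp).2 hR), hp⟩

theorem weight_eq {k n : ℕ} (hn : 2 ≤ n) (N : Net k n) (R : Finset (Finset (Fin (n ^ 2))))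
    (hR : R ⊆ N.lineSet) (p : Fin (n ^ 2)) :
    weight R p = ∑ i, if N.OnRel R p i then 1 else 0 := by
  have h1 : R.filter (fun ℓ => p ∈ ℓ) =
      Finset.univ.biUnion (fun i => (R ∩ N.classes i).filter (fun ℓ => p ∈ ℓ)) := by
    ext ℓ
    simp only [Finset.mem_filter, Finset.mem_biUnion, Finset.mem_inter, Finset.mem_univ, true_and]
    constructor
    · rintro ⟨h, hp⟩
      have := hR h
      simp only [lineSet, Finset.mem_biUnion, Finset.mem_univ, true_and] at this
      obtain ⟨i, hi⟩ := this
      exact ⟨i, ⟨h, hi⟩, hp⟩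
    · rintro ⟨i, ⟨h, hi⟩, hp⟩
      exact ⟨h, hp⟩
  rw [weight, h1, Finset.card_biUnion]
  · refine Finset.sum_congr rfl fun i _ => ?_
    split_ifs with h
    · obtain ⟨m, hm, hpm⟩ := h
      rw [Finset.card_eq_one]
      refine ⟨m, ?_⟩
      ext m'
      rw [Finset.mem_filter, Finset.mem_singleton]
      constructor
      · rintro ⟨hm', hp'⟩
        by_contra hne
        exact Finset.disjoint_left.1 (N.disjoint_within i m' (Finset.mem_inter.1 hm').2 m
          (Finset.mem_inter.1 hm).2 hne) hp' hpm
      · rintro rfl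
        exact ⟨hm, hpm⟩
    · rw [Finset.card_eq_zero, Finset.filter_eq_empty_iff]
      intro m hm hp
      exact h ⟨m, hm, hp⟩
  · intro i _ j _ hij
    refine Finset.disjoint_left.2 fun m hm hm' => ?_
    have h1 := (Finset.mem_inter.1 (Finset.mem_filter.1 hm).1).2
    have h2 := (Finset.mem_inter.1 (Finset.mem_filter.1 hm').1).2
    have h3 := N.one_point i j hij m h1 m h2
    rw [Finset.inter_self, N.card_line i m h1] at h3
    omega

theorem sum_weight {k n : ℕ} (hn : 2 ≤ n) (N : Net k n) (R : Finset (Finset (Fin (n ^ 2))))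
    (hR : R ⊆ N.lineSet) (ℓ : Finset (Fin (n ^ 2))) :
    ∑ p ∈ ℓ, weight R p = ∑ i, (ℓ.filter (fun p => N.OnRel R p i)).card := by
  rw [Finset.sum_congr rfl (fun p _ => N.weight_eq hn R hR p), Finset.sum_comm]
  refine Finset.sum_congr rfl fun i _ => ?_
  rw [Finset.card_filter]

/-- On a non-relational line of `Π_a` all weights are one. -/
theorem weight_one (N : Net 5 10) (R : Finset (Finset (Fin (10 ^ 2))))
    (hR : N.IsOddRelation R) (a b : Fin 5)
    (hab : ∀ f : Fin 5 → ℕ, ∑ i, f i = f a + f b + f 2 + f 3 + f 4)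
    (hne : a ≠ b ∧ a ≠ 2 ∧ a ≠ 3 ∧ a ≠ 4)
    (h1 : N.relType R b = 4)
    (h2 : N.relType R 2 = 2) (h3 : N.relType R 3 = 2) (h4 : N.relType R 4 = 2)
    (p : Fin (10 ^ 2)) (hp : ¬ N.OnRel R p a) : weight R p = 1 := by
  obtain ⟨ℓ, hℓ, hpℓ⟩ := N.exists_line a p
  have hs := N.sum_weight (by norm_num) R hR.1 ℓ
  rw [hab, N.card_filter_onRel R hne.1 hℓ, N.card_filter_onRel R hne.2.1 hℓ,
    N.card_filter_onRel R hne.2.2.1 hℓ, N.card_filter_onRel R hne.2.2.2 hℓ, h1, h2, h3, h4] at hs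
  have h0 : (ℓ.filter (fun p => N.OnRel R p a)).card = 0 := by
    rw [Finset.card_eq_zero, Finset.filter_eq_empty_iff]
    intro q hq h
    exact hp ((N.onRel_iff_of_mem R hℓ hpℓ).2 ((N.onRel_iff_of_mem R hℓ hq).1 h))
  rw [h0] at hs
  have hc : ∑ q ∈ ℓ, 1 = ∑ q ∈ ℓ, weight R q := by
    rw [hs, ← Finset.card_eq_sum_ones, N.card_line a ℓ hℓ]
  have hle : ∀ q ∈ ℓ, 1 ≤ weight R q := fun q _ => (hR.2 q).pos
  exact ((Finset.sum_eq_sum_iff_of_le hle).1 hc p hpℓ).symm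

theorem part_ii (N : Net 5 10) (R : Finset (Finset (Fin (10 ^ 2))))
    (hR : N.IsOddRelation R) (a b : Fin 5)
    (hab : ∀ f : Fin 5 → ℕ, ∑ i, f i = f a + f b + f 2 + f 3 + f 4)
    (hne : a ≠ b ∧ a ≠ 2 ∧ a ≠ 3 ∧ a ≠ 4)
    (h1 : N.relType R b = 4)
    (h2 : N.relType R 2 = 2) (h3 : N.relType R 3 = 2) (h4 : N.relType R 4 = 2)
    (hb : ∀ p, ¬ N.OnRel R p b → weight R p = 1) (ℓ : Finset (Fin (10 ^ 2)))
    (hℓ : ℓ ∈ R ∩ N.classes a) :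
        (ℓ.filter (fun p => N.OnRel R p b)).card = 4 ∧
        (ℓ.filter (fun p => N.OnRel R p b ∧ Net.weight R p = 5)).card = 1 ∧
        (∀ p ∈ ℓ, N.OnRel R p b → Net.weight R p = 5 →
          N.OnRel R p 2 ∧ N.OnRel R p 3 ∧ N.OnRel R p 4) ∧
        (ℓ.filter (fun p => N.OnRel R p b ∧ Net.weight R p = 3)).card = 3 ∧
        (∀ p ∈ ℓ, N.OnRel R p b → Net.weight R p = 3 →
          ∃! i : Fin 5, i ∈ ({2, 3, 4} : Finset (Fin 5)) ∧ N.OnRel R p i) ∧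
        (∀ i ∈ ({2, 3, 4} : Finset (Fin 5)),
          (ℓ.filter (fun p => N.OnRel R p b ∧ Net.weight R p = 3 ∧
            N.OnRel R p i)).card = 1) := by
  obtain ⟨hℓR, hℓ⟩ := Finset.mem_inter.1 hℓ
  have hw : ∀ p, weight R p = (if N.OnRel R p a then 1 else 0) + (if N.OnRel R p b then 1 else 0)
    + (if N.OnRel R p 2 then 1 else 0) + (if N.OnRel R p 3 then 1 else 0)
    + (if N.OnRel R p 4 then 1 else 0) := fun p => by
      rw [N.weight_eq (by norm_num) R hR.1, hab]
  have ha : ∀ p ∈ ℓ, N.OnRel R p a := fun p hp => (N.onRel_iff_of_mem R hℓ hp).2 hℓR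
  have cb := N.card_filter_onRel R hne.1 hℓ
  have c2 := N.card_filter_onRel R hne.2.1 hℓ
  have c3 := N.card_filter_onRel R hne.2.2.1 hℓ
  have c4 := N.card_filter_onRel R hne.2.2.2 hℓ
  have ca : (ℓ.filter (fun p => N.OnRel R p a)).card = 10 := by
    rw [Finset.filter_true_of_mem ha, N.card_line a ℓ hℓ]
  have hs := N.sum_weight (by norm_num) R hR.1 ℓ
  rw [hab, ca, cb, c2, c3, c4, h1, h2, h3, h4] at hs
  rw [h1] at cb
  rw [h2] at c2
  rw [h3] at c3
  rw [h4] at c4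
  have h53 : ∀ p ∈ ℓ, N.OnRel R p b → weight R p = 5 ∨ weight R p = 3 := by
    intro p hp hpb
    have ho : Odd (weight R p) := hR.2 p
    have h := hw p
    rw [if_pos (ha p hp), if_pos hpb] at h
    rw [Nat.odd_iff] at ho
    split_ifs at h <;> omega
  -- the weight as a combination of indicator functions
  have hcomb : ∀ p ∈ ℓ, weight R p = 1 + 4 * (if N.OnRel R p b ∧ weight R p = 5 then 1 else 0)
      + 2 * (if N.OnRel R p b ∧ weight R p = 3 then 1 else 0) := by
    intro p hp
    by_cases hpb : N.OnRel R p b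
    · rcases h53 p hp hpb with h | h <;> simp [hpb, h]
    · simp [hpb, hb p hpb]
  rw [Finset.sum_congr rfl hcomb, Finset.sum_add_distrib, Finset.sum_add_distrib,
    ← Finset.mul_sum, ← Finset.mul_sum, ← Finset.card_filter, ← Finset.card_filter,
    ← Finset.card_eq_sum_ones, N.card_line a ℓ hℓ] at hs
  have hbc : ∀ p ∈ ℓ, (if N.OnRel R p b then 1 else 0) =
      (if N.OnRel R p b ∧ weight R p = 5 then 1 else 0)
      + (if N.OnRel R p b ∧ weight R p = 3 then 1 else 0) := by
    intro p hp
    by_cases hpb : N.OnRel R p b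
    · rcases h53 p hp hpb with h | h <;> simp [hpb, h]
    · simp [hpb]
  have hcb := cb
  rw [Finset.card_filter, Finset.sum_congr rfl hbc, Finset.sum_add_distrib,
    ← Finset.card_filter, ← Finset.card_filter] at hcb
  have h5 : (ℓ.filter (fun p => N.OnRel R p b ∧ Net.weight R p = 5)).card = 1 := by omega
  have h3' : (ℓ.filter (fun p => N.OnRel R p b ∧ Net.weight R p = 3)).card = 3 := by omega
  have all5 : ∀ p ∈ ℓ, N.OnRel R p b → Net.weight R p = 5 →
          N.OnRel R p 2 ∧ N.OnRel R p 3 ∧ N.OnRel R p 4 := by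
    intro p hp hpb h
    have h' := hw p
    rw [if_pos (ha p hp), if_pos hpb] at h'
    refine ⟨?_, ?_, ?_⟩ <;> by_contra hc <;> rw [if_neg hc] at h' <;> split_ifs at h' <;> omega
  refine ⟨cb, h5, all5, h3', ?_, ?_⟩
  · intro p hp hpb h
    have h' := hw p
    rw [if_pos (ha p hp), if_pos hpb, h] at h'
    have key : ∀ i : Fin 5, (i ∈ ({2, 3, 4} : Finset (Fin 5)) ∧ N.OnRel R p i) ↔
        (i = 2 ∧ N.OnRel R p 2) ∨ (i = 3 ∧ N.OnRel R p 3) ∨ (i = 4 ∧ N.OnRel R p 4) := by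
      intro i
      simp only [Finset.mem_insert, Finset.mem_singleton]
      constructor
      · rintro ⟨rfl | rfl | rfl, h⟩ <;> tauto
      · rintro (⟨rfl, h⟩ | ⟨rfl, h⟩ | ⟨rfl, h⟩) <;> tauto
    simp only [key]
    by_cases x2 : N.OnRel R p 2 <;> by_cases x3 : N.OnRel R p 3 <;>
      by_cases x4 : N.OnRel R p 4 <;> simp [x2, x3, x4] at h' ⊢
  · intro i hi
    have hi4 : i = 2 ∨ i = 3 ∨ i = 4 := by simpa using hi
    have ci : (ℓ.filter (fun p => N.OnRel R p i)).card = 2 := by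
      rcases hi4 with rfl | rfl | rfl <;> assumption
    have hic : ∀ p ∈ ℓ, (if N.OnRel R p i then 1 else 0) =
        (if N.OnRel R p b ∧ weight R p = 5 then 1 else 0)
        + (if N.OnRel R p b ∧ weight R p = 3 ∧ N.OnRel R p i then 1 else 0) := by
      intro p hp
      by_cases hpb : N.OnRel R p b
      · rcases h53 p hp hpb with h | h
        · have := all5 p hp hpb h
          have hpi : N.OnRel R p i := by rcases hi4 with rfl | rfl | rfl <;> tauto
          simp [hpb, h, hpi]
        · simp [hpb, h]
      · have hpi : ¬ N.OnRel R p i := by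
          intro hpi
          have h' := hw p
          rw [if_pos (ha p hp), hb p hpb] at h'
          rcases hi4 with rfl | rfl | rfl <;> rw [if_pos hpi] at h' <;> omega
        simp [hpb, hpi]
    rw [Finset.card_filter, Finset.sum_congr rfl hic, Finset.sum_add_distrib,
      ← Finset.card_filter, ← Finset.card_filter, h5] at ci
    omega

theorem part_iii (N : Net 5 10) (R : Finset (Finset (Fin (10 ^ 2))))
    (hR : N.IsOddRelation R) (a b : Fin 5)
    (hab : ∀ f : Fin 5 → ℕ, ∑ i, f i = f a + f b + f 2 + f 3 + f 4)
    (hne : a ≠ b ∧ a ≠ 2 ∧ a ≠ 3 ∧ a ≠ 4)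
    (h1 : N.relType R b = 4)
    (h2 : N.relType R 2 = 2) (h3 : N.relType R 3 = 2) (h4 : N.relType R 4 = 2)
    (haw : ∀ p, ¬ N.OnRel R p a → weight R p = 1) (ℓ : Finset (Fin (10 ^ 2)))
    (hℓ : ℓ ∈ N.classes a) (hℓR : ℓ ∉ R) :
        (ℓ.filter (fun p => ∃ m ∈ N.classes b, m ∉ R ∧ p ∈ m)).card = 6 ∧
        (∀ i ∈ ({2, 3, 4} : Finset (Fin 5)),
          (ℓ.filter (fun p => (∃ m ∈ N.classes b, m ∉ R ∧ p ∈ m) ∧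
            N.OnRel R p i)).card = 2) := by
  have cb := N.card_filter_onRel R hne.1 hℓ
  rw [h1] at cb
  constructor
  · have e : ℓ.filter (fun p => ∃ m ∈ N.classes b, m ∉ R ∧ p ∈ m) =
        ℓ.filter (fun p => ¬ N.OnRel R p b) :=
      Finset.filter_congr fun p _ => N.nonrel_iff R b p
    have := Finset.card_filter_add_card_filter_not (s := ℓ) (fun p => N.OnRel R p b)
    rw [cb, N.card_line a ℓ hℓ] at this
    rw [e]
    omega
  · intro i hi
    have hi4 : i = 2 ∨ i = 3 ∨ i = 4 := by simpa using hi
    have ci : (ℓ.filter (fun p => N.OnRel R p i)).card = 2 := by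
      rcases hi4 with rfl | rfl | rfl
      · rw [N.card_filter_onRel R hne.2.1 hℓ, h2]
      · rw [N.card_filter_onRel R hne.2.2.1 hℓ, h3]
      · rw [N.card_filter_onRel R hne.2.2.2 hℓ, h4]
    refine Eq.trans (congrArg Finset.card ?_) ci
    refine Finset.filter_congr fun p hp => ?_
    rw [N.nonrel_iff R b p]
    refine ⟨fun h => h.2, fun hpi => ⟨fun hpb => ?_, hpi⟩⟩
    have h' := N.weight_eq (by norm_num) R hR.1 p
    rw [hab, haw p (fun h => hℓR ((N.onRel_iff_of_mem R hℓ hp).1 h)), if_pos hpb] at h'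
    rcases hi4 with rfl | rfl | rfl <;> rw [if_pos hpi] at h' <;> omega

end Net

/-- structural properties of an odd relation of type `(4,4,2,2,2)`
on a 5-net of order 10 (see Lemma 3.4 of the paper).
(i) Every point on a relational line of exactly one of `Π₀, Π₁` lies on no
relational line of `Π₂, Π₃, Π₄` (so has weight 1).
(ii) For every relational line `ℓ` of `Π₀`, the four points of `ℓ` on relational
lines of `Π₁` consist of one point of weight 5, lying on relational lines of all of
`Π₂, Π₃, Π₄`, and three points of weight 3, each on a relational line of exactly one
of `Π₂, Π₃, Π₄`, each of `Π₂, Π₃, Π₄` accounting for exactly one of them; and the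
same with `Π₀` and `Π₁` exchanged.
(iii) Every point on no relational line of `Π₀` nor of `Π₁` lies on exactly one
relational line of `Π₂ ∪ Π₃ ∪ Π₄` (so has weight 1), and for every non-relational
line `ℓ` of `Π₀` and each `i ∈ {2,3,4}`, exactly two of the six points of `ℓ` lying
on non-relational lines of `Π₁` lie on a relational line of `Π_i`; and the same with
`Π₀` and `Π₁` exchanged. -/
theorem statement13 (N : Net 5 10) (R : Finset (Finset (Fin (10 ^ 2))))
    (hR : N.IsOddRelation R)
    (h0 : N.relType R 0 = 4) (h1 : N.relType R 1 = 4)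
    (h2 : N.relType R 2 = 2) (h3 : N.relType R 3 = 2) (h4 : N.relType R 4 = 2) :
    -- (i)
    (∀ p : Fin (10 ^ 2), Xor' (N.OnRel R p 0) (N.OnRel R p 1) →
      ¬ N.OnRel R p 2 ∧ ¬ N.OnRel R p 3 ∧ ¬ N.OnRel R p 4 ∧ Net.weight R p = 1) ∧
    -- (ii), stated for both orderings (a,b) = (0,1) and (a,b) = (1,0)
    (∀ a b : Fin 5, ((a, b) = ((0 : Fin 5), (1 : Fin 5)) ∨
        (a, b) = ((1 : Fin 5), (0 : Fin 5))) →
      ∀ ℓ ∈ R ∩ N.classes a,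
        (ℓ.filter (fun p => N.OnRel R p b)).card = 4 ∧
        (ℓ.filter (fun p => N.OnRel R p b ∧ Net.weight R p = 5)).card = 1 ∧
        (∀ p ∈ ℓ, N.OnRel R p b → Net.weight R p = 5 →
          N.OnRel R p 2 ∧ N.OnRel R p 3 ∧ N.OnRel R p 4) ∧
        (ℓ.filter (fun p => N.OnRel R p b ∧ Net.weight R p = 3)).card = 3 ∧
        (∀ p ∈ ℓ, N.OnRel R p b → Net.weight R p = 3 →
          ∃! i : Fin 5, i ∈ ({2, 3, 4} : Finset (Fin 5)) ∧ N.OnRel R p i) ∧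
        (∀ i ∈ ({2, 3, 4} : Finset (Fin 5)),
          (ℓ.filter (fun p => N.OnRel R p b ∧ Net.weight R p = 3 ∧
            N.OnRel R p i)).card = 1)) ∧
    -- (iii)
    (∀ p : Fin (10 ^ 2), ¬ N.OnRel R p 0 → ¬ N.OnRel R p 1 →
      (∃! ℓ, ℓ ∈ R ∧ (ℓ ∈ N.classes 2 ∨ ℓ ∈ N.classes 3 ∨ ℓ ∈ N.classes 4) ∧ p ∈ ℓ) ∧
      Net.weight R p = 1) ∧
    (∀ a b : Fin 5, ((a, b) = ((0 : Fin 5), (1 : Fin 5)) ∨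
        (a, b) = ((1 : Fin 5), (0 : Fin 5))) →
      ∀ ℓ ∈ N.classes a, ℓ ∉ R →
        (ℓ.filter (fun p => ∃ m ∈ N.classes b, m ∉ R ∧ p ∈ m)).card = 6 ∧
        (∀ i ∈ ({2, 3, 4} : Finset (Fin 5)),
          (ℓ.filter (fun p => (∃ m ∈ N.classes b, m ∉ R ∧ p ∈ m) ∧
            N.OnRel R p i)).card = 2)) := by
  have s01 : ∀ f : Fin 5 → ℕ, ∑ i, f i = f 0 + f 1 + f 2 + f 3 + f 4 := fun f =>
    Fin.sum_univ_five f
  have s10 : ∀ f : Fin 5 → ℕ, ∑ i, f i = f 1 + f 0 + f 2 + f 3 + f 4 := fun f => by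
    rw [Fin.sum_univ_five f, add_comm (f 0)]
  have n01 : (0 : Fin 5) ≠ 1 ∧ (0 : Fin 5) ≠ 2 ∧ (0 : Fin 5) ≠ 3 ∧ (0 : Fin 5) ≠ 4 := by decide
  have n10 : (1 : Fin 5) ≠ 0 ∧ (1 : Fin 5) ≠ 2 ∧ (1 : Fin 5) ≠ 3 ∧ (1 : Fin 5) ≠ 4 := by decide
  have w0 := N.weight_one R hR 0 1 s01 n01 h1 h2 h3 h4
  have w1 := N.weight_one R hR 1 0 s10 n10 h0 h2 h3 h4
  refine ⟨?_, ?_, ?_, ?_⟩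
  · intro p hx
    have hw : Net.weight R p = 1 := by
      rcases hx with ⟨_, h⟩ | ⟨_, h⟩
      · exact w1 p h
      · exact w0 p h
    have h' := N.weight_eq (by norm_num) R hR.1 p
    rw [s01, hw] at h'
    have h01 : (if N.OnRel R p 0 then 1 else 0) + (if N.OnRel R p 1 then 1 else 0) = 1 := by
      rcases hx with ⟨h, h'⟩ | ⟨h, h'⟩ <;> rw [if_pos h, if_neg h']
    rw [h01] at h'
    refine ⟨?_, ?_, ?_, hw⟩ <;> intro hc <;> rw [if_pos hc] at h' <;> omega
  · rintro a b (h | h) ℓ hℓ <;> rw [Prod.mk.injEq] at h <;> obtain ⟨rfl, rfl⟩ := h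
    · exact N.part_ii R hR 0 1 s01 n01 h1 h2 h3 h4 w1 ℓ hℓ
    · exact N.part_ii R hR 1 0 s10 n10 h0 h2 h3 h4 w0 ℓ hℓ
  · intro p hp0 hp1
    have hw := w0 p hp0
    refine ⟨?_, hw⟩
    obtain ⟨ℓ, hℓ⟩ := Finset.card_eq_one.1 hw
    have hmem : ∀ m, (m ∈ R ∧ p ∈ m) ↔ m = ℓ := fun m => by
      rw [← Finset.mem_singleton, ← hℓ, Finset.mem_filter]
    have hl := (hmem ℓ).2 rfl
    refine ⟨ℓ, ⟨hl.1, ?_, hl.2⟩, fun m hm => (hmem m).1 ⟨hm.1, hm.2.2⟩⟩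
    have := hR.1 hl.1
    simp only [Net.lineSet, Finset.mem_biUnion, Finset.mem_univ, true_and] at this
    obtain ⟨i, hi⟩ := this
    have hon : N.OnRel R p i := (N.onRel_iff_of_mem R hi hl.2).2 hl.1
    fin_cases i
    · exact absurd hon hp0
    · exact absurd hon hp1
    · exact Or.inl hi
    · exact Or.inr (Or.inl hi)
    · exact Or.inr (Or.inr hi)
  · rintro a b (h | h) ℓ hℓ hℓR <;> rw [Prod.mk.injEq] at h <;> obtain ⟨rfl, rfl⟩ := h
    · exact N.part_iii R hR 0 1 s01 n01 h1 h2 h3 h4 w0 ℓ hℓ hℓR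
    · exact N.part_iii R hR 1 0 s10 n10 h0 h2 h3 h4 w1 ℓ hℓ hℓR
end

section
/- There exists a pair (L_0, L_1) of orthogonal Latin squares of order 10 such that the associated 4-net admits a non-trivial relation of type (4,4,4,4) and such that L_0 and L_1 have five pairwise disjoint common transversals. -/
open scoped Classical

/-- A Latin square of order 10 on the symbol set `Fin 10`: every symbol occurs
exactly once in each row and each column. -/
def IsLatin (L : Fin 10 → Fin 10 → Fin 10) : Prop :=
  (∀ i, Function.Injective (L i)) ∧ (∀ j, Function.Injective fun i => L i j)

/-- Orthogonality of two Latin squares: the 100 ordered pairs of entries are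
pairwise distinct. -/
def IsOrtho (L0 L1 : Fin 10 → Fin 10 → Fin 10) : Prop :=
  Function.Injective fun p : Fin 10 × Fin 10 => (L0 p.1 p.2, L1 p.1 p.2)

/-- The line of cells in row `r`. -/
def rowLine (r : Fin 10) : Finset (Fin 10 × Fin 10) :=
  Finset.univ.filter fun p => p.1 = r

/-- The line of cells in column `c`. -/
def colLine (c : Fin 10) : Finset (Fin 10 × Fin 10) :=
  Finset.univ.filter fun p => p.2 = c

/-- The symbol line of `s` in the square `L`: the cells carrying the symbol `s`. -/
def symLine (L : Fin 10 → Fin 10 → Fin 10) (s : Fin 10) : Finset (Fin 10 × Fin 10) :=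
  Finset.univ.filter fun p => L p.1 p.2 = s

/-- The four parallel classes of the 4-net associated to a pair of orthogonal Latin
squares: rows, columns, symbol lines of `L0`, symbol lines of `L1`. -/
def netClasses (L0 L1 : Fin 10 → Fin 10 → Fin 10) :
    Fin 4 → Finset (Finset (Fin 10 × Fin 10)) :=
  ![Finset.univ.image rowLine, Finset.univ.image colLine,
    Finset.univ.image (symLine L0), Finset.univ.image (symLine L1)]

/-- A relation on the 4-net associated to the pair `(L0, L1)`: a set of lines of the
net such that every point lies on an even number of them. -/
def IsNetRelation (L0 L1 : Fin 10 → Fin 10 → Fin 10)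
    (R : Finset (Finset (Fin 10 × Fin 10))) : Prop :=
  R ⊆ Finset.univ.biUnion (netClasses L0 L1) ∧
  ∀ p : Fin 10 × Fin 10, Even (R.filter fun ℓ => p ∈ ℓ).card

/-- A relation is trivial if it is a union of parallel classes. -/
def IsTrivialRel (L0 L1 : Fin 10 → Fin 10 → Fin 10)
    (R : Finset (Finset (Fin 10 × Fin 10))) : Prop :=
  ∃ s : Finset (Fin 4), R = s.biUnion (netClasses L0 L1)

/-- A common transversal of the pair `(L0, L1)`: a set of cells meeting every row
exactly once and every column exactly once, and carrying 10 pairwise distinct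
symbols in each of the two squares. -/
def IsCommonTransversal (L0 L1 : Fin 10 → Fin 10 → Fin 10)
    (T : Finset (Fin 10 × Fin 10)) : Prop :=
  (∀ r, (T.filter fun p => p.1 = r).card = 1) ∧
  (∀ c, (T.filter fun p => p.2 = c).card = 1) ∧
  (T.image fun p => L0 p.1 p.2).card = 10 ∧
  (T.image fun p => L1 p.1 p.2).card = 10

def sqA : Fin 10 → Fin 10 → Fin 10 :=
  ![![0, 4, 5, 6, 1, 2, 3, 7, 8, 9],
    ![8, 1, 4, 9, 7, 6, 0, 2, 3, 5],
    ![7, 8, 2, 5, 9, 0, 4, 1, 6, 3],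
    ![9, 6, 7, 3, 2, 4, 8, 5, 1, 0],
    ![2, 7, 8, 0, 6, 3, 1, 9, 5, 4],
    ![1, 5, 3, 4, 0, 9, 7, 6, 2, 8],
    ![5, 9, 0, 1, 3, 8, 2, 4, 7, 6],
    ![4, 0, 1, 8, 5, 7, 6, 3, 9, 2],
    ![6, 3, 9, 2, 4, 1, 5, 8, 0, 7],
    ![3, 2, 6, 7, 8, 5, 9, 0, 4, 1]]

def sqB : Fin 10 → Fin 10 → Fin 10 :=
  ![![0, 4, 6, 8, 7, 5, 9, 1, 2, 3],
    ![8, 1, 9, 7, 3, 0, 5, 4, 6, 2],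
    ![9, 6, 2, 5, 1, 4, 0, 8, 3, 7],
    ![4, 5, 7, 3, 8, 2, 1, 0, 9, 6],
    ![7, 0, 3, 9, 6, 1, 2, 5, 4, 8],
    ![6, 3, 4, 1, 2, 9, 8, 7, 0, 5],
    ![1, 2, 8, 4, 0, 7, 3, 6, 5, 9],
    ![3, 7, 5, 0, 9, 6, 4, 2, 8, 1],
    ![2, 8, 0, 6, 5, 3, 7, 9, 1, 4],
    ![5, 9, 1, 2, 4, 8, 6, 3, 7, 0]]

def trCol : Fin 5 → Fin 10 → Fin 10 :=
  ![![1, 0, 3, 2, 4, 5, 6, 7, 8, 9],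
    ![4, 5, 2, 6, 3, 1, 7, 8, 9, 0],
    ![5, 9, 4, 3, 1, 0, 2, 6, 7, 8],
    ![7, 2, 8, 0, 6, 9, 4, 1, 3, 5],
    ![8, 4, 5, 7, 0, 3, 9, 2, 1, 6]]

def trSet (a : Fin 5) : Finset (Fin 10 × Fin 10) :=
  Finset.univ.filter fun p => trCol a p.1 = p.2

/-- The relation: the lines with index less than 4 in each parallel class. -/
def relR : Finset (Finset (Fin 10 × Fin 10)) :=
  ({0, 1, 2, 3} : Finset (Fin 10)).image rowLine ∪ ({0, 1, 2, 3} : Finset (Fin 10)).image colLine ∪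
  (({0, 1, 2, 3} : Finset (Fin 10)).image (symLine sqA) ∪
    ({0, 1, 2, 3} : Finset (Fin 10)).image (symLine sqB))

theorem latA : IsLatin sqA := by
  unfold IsLatin Function.Injective
  decide +kernel

theorem latB : IsLatin sqB := by
  unfold IsLatin Function.Injective
  decide +kernel

theorem orthoAB : IsOrtho sqA sqB := by
  unfold IsOrtho Function.Injective
  decide +kernel

theorem rel_sub : relR ⊆ Finset.univ.biUnion (netClasses sqA sqB) := by
  decide +kernel

theorem rel_even : ∀ p : Fin 10 × Fin 10, Even (relR.filter fun ℓ => p ∈ ℓ).card := by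
  decide +kernel

theorem rel_not : ∀ i, ¬ netClasses sqA sqB i ⊆ relR := by
  decide +kernel

theorem rel_type : ∀ i : Fin 4, (relR ∩ netClasses sqA sqB i).card = 4 := by
  decide +kernel

theorem rel_nontriv : ¬ IsTrivialRel sqA sqB relR := by
  rintro ⟨s, hs⟩
  have h0 : s = ∅ := by
    rw [Finset.eq_empty_iff_forall_notMem]
    intro i hi
    apply rel_not i
    rw [hs]
    exact Finset.subset_biUnion_of_mem _ hi
  have h1 : rowLine 0 ∈ relR := by simp [relR]
  rw [hs, h0] at h1
  simp at h1

theorem trans_all : ∀ a, IsCommonTransversal sqA sqB (trSet a) := by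
  unfold IsCommonTransversal
  decide +kernel

theorem trans_disj : ∀ a b, a ≠ b → Disjoint (trSet a) (trSet b) := by
  intro a b hab
  have key : ∀ a b : Fin 5, a ≠ b → ∀ r, trCol a r ≠ trCol b r := by decide +kernel
  rw [Finset.disjoint_left]
  intro p hp hq
  simp only [trSet, Finset.mem_filter, Finset.mem_univ, true_and] at hp hq
  exact key a b hab p.1 (hp.trans hq.symm)

/-- there exists a pair of orthogonal Latin squares of order 10 whose
associated 4-net admits a non-trivial relation of type `(4,4,4,4)` and which has
five pairwise disjoint common transversals. -/
theorem statement16 :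
    ∃ L0 L1 : Fin 10 → Fin 10 → Fin 10,
      IsLatin L0 ∧ IsLatin L1 ∧ IsOrtho L0 L1 ∧
      (∃ R : Finset (Finset (Fin 10 × Fin 10)),
        IsNetRelation L0 L1 R ∧ ¬ IsTrivialRel L0 L1 R ∧
        ∀ i : Fin 4, (R ∩ netClasses L0 L1 i).card = 4) ∧
      (∃ T : Fin 5 → Finset (Fin 10 × Fin 10),
        (∀ a, IsCommonTransversal L0 L1 (T a)) ∧
        (∀ a b, a ≠ b → Disjoint (T a) (T b))) := by
  exact ⟨sqA, sqB, latA, latB, orthoAB, ⟨relR, ⟨rel_sub, rel_even⟩, rel_nontriv, rel_type⟩,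
    trSet, trans_all, trans_disj⟩
end
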